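/- Let f ∈ ℤ[X] be a polynomial of degree 2 or 3. Then there exists an integer G ≥ 2 such that for every integer k ≥ G there exist infinitely many integers n ≥ 0 with the property that none of the values f(n+1), f(n+2), …, f(n+k) is coprime to all the others; that is, for every i ∈ {1,…,k} there exists j ∈ {1,…,k} with j ≠ i and gcd(f(n+i), f(n+j)) > 1. -/

import Mathlib

open Polynomial NumberField

/-- The indices `i ∈ {1, …, k}` for which, at the shift `c`, the prime `p` divides `f (c + i)` and
also `f (c + j)` for some other index `j`. -/
noncomputable def coveredBy (f : ℤ[X]) (k p : ℕ) (c : ℤ) : Finset ℕ :=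
  open Classical in
  (Finset.Icc 1 k).filter fun i => ∃ j ∈ Finset.Icc 1 k, j ≠ i ∧
    (p : ℤ) ∣ f.eval (c + i) ∧ (p : ℤ) ∣ f.eval (c + j)

theorem mem_coveredBy {f : ℤ[X]} {k p : ℕ} {c : ℤ} {i : ℕ} :
    i ∈ coveredBy f k p c ↔ i ∈ Finset.Icc 1 k ∧ ∃ j ∈ Finset.Icc 1 k, j ≠ i ∧
      (p : ℤ) ∣ f.eval (c + i) ∧ (p : ℤ) ∣ f.eval (c + j) := by
  simp [coveredBy]

theorem dvd_eval_of_dvd_sub {f : ℤ[X]} {p x y : ℤ} (h : p ∣ x - y) (hy : p ∣ f.eval y) :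
    p ∣ f.eval x := by
  have := h.trans (f.sub_dvd_eval_sub x y)
  exact (dvd_sub_left hy).mp this

theorem exists_forall_dvd_sub (Q : Finset ℕ) (hQ : ∀ p ∈ Q, p.Prime) (c : ℕ → ℤ) :
    ∃ n₀ : ℕ, ∀ p ∈ Q, (p : ℤ) ∣ n₀ - c p := by
  let a : ℕ → ℕ := fun p => (c p % p).toNat
  have hco : Set.Pairwise (Q : Set ℕ) (Function.onFun Nat.Coprime fun p => p) := by
    intro p hp q hq hpq
    exact (Nat.coprime_primes (hQ p hp) (hQ q hq)).mpr hpq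
  obtain ⟨n, hn⟩ := Nat.chineseRemainderOfFinset a (fun p => p) Q
    (fun p hp => (hQ p hp).ne_zero) hco
  refine ⟨n, fun p hp => ?_⟩
  have h1 := hn p hp
  have hp0 : (p : ℤ) ≠ 0 := by exact_mod_cast (hQ p hp).ne_zero
  have h2 : ((a p : ℕ) : ℤ) = c p % p := Int.toNat_of_nonneg (Int.emod_nonneg _ hp0)
  have h3 : (n : ℤ) ≡ c p [ZMOD p] := by
    have := (Int.natCast_modEq_iff.mpr h1)
    rw [h2] at this
    exact this.trans (Int.mod_modEq _ _)
  exact h3.symm.dvd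

theorem exists_forall_eval_ne_zero {f : ℤ[X]} (hf : f ≠ 0) :
    ∃ B : ℤ, ∀ x : ℤ, B < x → f.eval x ≠ 0 := by
  obtain ⟨B, hB⟩ := f.roots.toFinset.bddAbove
  refine ⟨B, fun x hx h => ?_⟩
  have : x ∈ (f.roots.toFinset : Set ℤ) := by simp [hf, h]
  exact absurd (hB this) (not_le.mpr hx)

theorem infinite_of_covering {f : ℤ[X]} (hf : f ≠ 0) {k : ℕ} (Q : Finset ℕ)
    (hQ : ∀ p ∈ Q, p.Prime) (c : ℕ → ℤ)
    (h : ∀ i ∈ Finset.Icc 1 k, ∃ p ∈ Q, i ∈ coveredBy f k p (c p)) :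
    {n : ℕ | ∀ i ∈ Finset.Icc 1 k, ∃ j ∈ Finset.Icc 1 k, j ≠ i ∧
        1 < Int.gcd (f.eval ((n + i : ℕ) : ℤ)) (f.eval ((n + j : ℕ) : ℤ))}.Infinite := by
  obtain ⟨n₀, hn₀⟩ := exists_forall_dvd_sub Q hQ c
  obtain ⟨B, hB⟩ := exists_forall_eval_ne_zero hf
  have hprod : 0 < ∏ p ∈ Q, p := Finset.prod_pos fun p hp => (hQ p hp).pos
  refine Set.infinite_of_forall_exists_gt fun m => ?_
  refine ⟨n₀ + (∏ p ∈ Q, p) * (m + B.toNat + 1), ?_, ?_⟩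
  · intro i hi
    obtain ⟨p, hp, hip⟩ := h i hi
    obtain ⟨-, j, hj, hji, h1, h2⟩ := mem_coveredBy.mp hip
    refine ⟨j, hj, hji, ?_⟩
    set n := n₀ + (∏ p ∈ Q, p) * (m + B.toNat + 1) with hn
    have hmod : (p : ℤ) ∣ n - c p := by
      have : (p : ℤ) ∣ ((∏ p ∈ Q, p : ℕ) : ℤ) * (m + B.toNat + 1) :=
        (Int.natCast_dvd_natCast.mpr (Finset.dvd_prod_of_mem _ hp)).mul_right _
      have h3 := dvd_add (hn₀ p hp) this
      have h4 : (n : ℤ) - c p = n₀ - c p + ((∏ p ∈ Q, p : ℕ) : ℤ) * (m + B.toNat + 1) := by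
        simp only [hn, Nat.cast_add, Nat.cast_mul, Nat.cast_one]
        ring
      rwa [h4]
    have key : ∀ l : ℕ, (p : ℤ) ∣ f.eval (c p + l) → (p : ℤ) ∣ f.eval ((n + l : ℕ) : ℤ) := by
      intro l hl
      refine dvd_eval_of_dvd_sub ?_ hl
      convert hmod using 1
      rw [Nat.cast_add]
      ring
    have hne : f.eval ((n + i : ℕ) : ℤ) ≠ 0 := by
      apply hB
      have h4 : B ≤ B.toNat := Int.self_le_toNat B
      have h5 : m + B.toNat + 1 ≤ (∏ p ∈ Q, p) * (m + B.toNat + 1) :=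
        Nat.le_mul_of_pos_left _ hprod
      omega
    have hdvd : p ∣ Int.gcd (f.eval ((n + i : ℕ) : ℤ)) (f.eval ((n + j : ℕ) : ℤ)) :=
      Int.dvd_gcd (key i h1) (key j h2)
    exact (hQ p hp).one_lt.trans_le (Nat.le_of_dvd (Int.gcd_pos_of_ne_zero_left _ hne) hdvd)
  · have h5 : m + B.toNat + 1 ≤ (∏ p ∈ Q, p) * (m + B.toNat + 1) :=
      Nat.le_mul_of_pos_left _ hprod
    omega

theorem mem_coveredBy_of_dvd_of_dvd {f : ℤ[X]} {k p d : ℕ} {x : ℤ} (hd : 0 < d) (hdk : 2 * d ≤ k)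
    (h0 : (p : ℤ) ∣ f.eval x) (h1 : (p : ℤ) ∣ f.eval (x + d)) {i : ℕ} (hi : i ∈ Finset.Icc 1 k) :
    ∃ c, i ∈ coveredBy f k p c := by
  rw [Finset.mem_Icc] at hi
  by_cases h : i + d ≤ k
  · refine ⟨x - i, mem_coveredBy.mpr ⟨by simpa using hi, i + d, by simp; omega, by omega, ?_, ?_⟩⟩
    · simpa using h0
    · convert h1 using 2
      push_cast
      ring
  · refine ⟨x + d - i,
      mem_coveredBy.mpr ⟨by simpa using hi, i - d, by simp; omega, by omega, ?_, ?_⟩⟩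
    · simpa using h1
    · convert h0 using 2
      push_cast [show d ≤ i by omega]
      ring

theorem mem_coveredBy_of_dvd_sub {f : ℤ[X]} {k p : ℕ} (hp : 0 < p) (hpk : 2 * p ≤ k) {c : ℤ}
    {i : ℕ} (hi : i ∈ Finset.Icc 1 k) (h : (p : ℤ) ∣ f.eval (c + i)) :
    i ∈ coveredBy f k p c := by
  rw [Finset.mem_Icc] at hi
  by_cases h' : i + p ≤ k
  · refine mem_coveredBy.mpr ⟨by simpa using hi, i + p, by simp; omega, by omega, h,
      dvd_eval_of_dvd_sub ?_ h⟩
    simp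
  · refine mem_coveredBy.mpr ⟨by simpa using hi, i - p, by simp; omega, by omega, h,
      dvd_eval_of_dvd_sub ?_ h⟩
    push_cast [show p ≤ i by omega]
    ring_nf
    simp

theorem exists_card_sdiff_coveredBy_le {f : ℤ[X]} {k p : ℕ} (hp : p.Prime) (hpk : 2 * p ≤ k)
    {x : ℤ} (hx : (p : ℤ) ∣ f.eval x) (R : Finset ℕ) (hR : R ⊆ Finset.Icc 1 k) :
    ∃ c, ((R \ coveredBy f k p c).card : ℝ) ≤ R.card * (1 - 1 / p) := by
  classical
  have hp0 : (0 : ℝ) < p := by exact_mod_cast hp.pos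
  obtain ⟨r, -, hr⟩ : ∃ r ∈ Finset.range p,
      (R.card : ℝ) / p ≤ (R.filter fun i => i % p = r).card := by
    apply Finset.exists_le_of_sum_le (Finset.nonempty_range_iff.mpr hp.ne_zero)
    rw [Finset.sum_const, Finset.card_range, nsmul_eq_mul, mul_div_cancel₀ _ hp0.ne',
      ← Nat.cast_sum, ← Finset.card_eq_sum_card_fiberwise]
    intro i _
    simpa using Nat.mod_lt i hp.pos
  refine ⟨x - r, ?_⟩
  have hsub : (R.filter fun i => i % p = r) ⊆ R ∩ coveredBy f k p (x - r) := by
    intro i hi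
    rw [Finset.mem_filter] at hi
    refine Finset.mem_inter.mpr ⟨hi.1, mem_coveredBy_of_dvd_sub hp.pos hpk (hR hi.1)
      (dvd_eval_of_dvd_sub ?_ hx)⟩
    have h1 : (p : ℤ) ∣ i - r := by
      rw [← hi.2]
      exact_mod_cast (Int.dvd_self_sub_emod : (p : ℤ) ∣ (i : ℤ) - (i : ℤ) % p)
    convert h1 using 1
    ring
  have h1 : ((R.filter fun i => i % p = r).card : ℝ) ≤ (R ∩ coveredBy f k p (x - r)).card := by
    exact_mod_cast Finset.card_le_card hsub
  have h2 := Finset.card_sdiff_add_card_inter R (coveredBy f k p (x - r))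
  have h3 : ((R \ coveredBy f k p (x - r)).card : ℝ) + (R ∩ coveredBy f k p (x - r)).card
      = R.card := by exact_mod_cast h2
  have h4 : (R.card : ℝ) * (1 - 1 / p) = R.card - R.card / p := by ring
  linarith

theorem one_sub_one_div_prime_nonneg {p : ℕ} (hp : p.Prime) : (0 : ℝ) ≤ 1 - 1 / p := by
  have : (1 : ℝ) ≤ p := by exact_mod_cast hp.one_lt.le
  rw [sub_nonneg, div_le_one (by linarith)]
  exact this

theorem exists_card_sdiff_biUnion_coveredBy_le {f : ℤ[X]} {k : ℕ} (S : Finset ℕ)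
    (hS : ∀ p ∈ S, p.Prime ∧ 2 * p ≤ k ∧ ∃ x : ℤ, (p : ℤ) ∣ f.eval x)
    (R : Finset ℕ) (hR : R ⊆ Finset.Icc 1 k) :
    ∃ c : ℕ → ℤ, ((R \ S.biUnion fun p => coveredBy f k p (c p)).card : ℝ)
      ≤ R.card * ∏ p ∈ S, (1 - 1 / (p : ℝ)) := by
  classical
  induction S using Finset.induction_on with
  | empty => exact ⟨0, by simp⟩
  | insert q S hq ih =>
    obtain ⟨c, hc⟩ := ih fun p hp => hS p (Finset.mem_insert_of_mem hp)
    obtain ⟨hq1, hq2, x, hx⟩ := hS q (Finset.mem_insert_self q S)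
    obtain ⟨b, hb⟩ := exists_card_sdiff_coveredBy_le hq1 hq2 hx
      (R \ S.biUnion fun p => coveredBy f k p (c p)) (Finset.sdiff_subset.trans hR)
    refine ⟨Function.update c q b, ?_⟩
    have hU : (S.biUnion fun p => coveredBy f k p (Function.update c q b p))
        = S.biUnion fun p => coveredBy f k p (c p) := by
      refine Finset.biUnion_congr rfl fun p hp => ?_
      rw [Function.update_of_ne (by rintro rfl; exact hq hp)]
    rw [Finset.biUnion_insert, hU, Function.update_self, Finset.union_comm,
      ← Finset.sup_eq_union, ← sdiff_sdiff_left, Finset.prod_insert hq]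
    refine hb.trans ?_
    calc _ ≤ (R.card * ∏ p ∈ S, (1 - 1 / (p : ℝ))) * (1 - 1 / q) :=
          mul_le_mul_of_nonneg_right hc (one_sub_one_div_prime_nonneg hq1)
      _ = _ := by ring

theorem exists_subset_biUnion_coveredBy {f : ℤ[X]} {k : ℕ} (T R : Finset ℕ)
    (hR : R ⊆ Finset.Icc 1 k) (hcard : R.card ≤ T.card)
    (hT : ∀ p ∈ T, ∀ i ∈ Finset.Icc 1 k, ∃ c, i ∈ coveredBy f k p c) :
    ∃ c : ℕ → ℤ, ∀ i ∈ R, ∃ p ∈ T, i ∈ coveredBy f k p (c p) := by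
  classical
  obtain ⟨T', hT', hcard'⟩ := Finset.exists_subset_card_eq hcard
  let e : T' ≃ R := Finset.equivOfCardEq hcard'
  choose! c hc using hT
  refine ⟨fun p => if h : p ∈ T' then c p (e ⟨p, h⟩) else 0, fun i hi => ?_⟩
  have hmem : ((e.symm ⟨i, hi⟩ : T') : ℕ) ∈ T' := (e.symm ⟨i, hi⟩).2
  refine ⟨e.symm ⟨i, hi⟩, hT' hmem, ?_⟩
  have := hc _ (hT' hmem) i (hR hi)
  simpa using this

/-- Primes of `M` cover with prescribed shifts, primes of `S` sieve the remaining indices greedily,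
and each prime of `T` covers one of those that are still left. -/
theorem infinite_of_sieve {f : ℤ[X]} (hf : f ≠ 0) {k : ℕ} (M S T : Finset ℕ)
    (hMS : Disjoint M S) (hMT : Disjoint M T) (hST : Disjoint S T)
    (hM : ∀ p ∈ M, p.Prime) (c₀ : ℕ → ℤ)
    (hS : ∀ p ∈ S, p.Prime ∧ 2 * p ≤ k ∧ ∃ x : ℤ, (p : ℤ) ∣ f.eval x)
    (hT : ∀ p ∈ T, p.Prime ∧ ∀ i ∈ Finset.Icc 1 k, ∃ c, i ∈ coveredBy f k p c)
    (R : Finset ℕ) (hR : R ⊆ Finset.Icc 1 k)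
    (hRM : ∀ i ∈ Finset.Icc 1 k, i ∉ R → ∃ p ∈ M, i ∈ coveredBy f k p (c₀ p))
    (hcard : (R.card : ℝ) * ∏ p ∈ S, (1 - 1 / (p : ℝ)) ≤ T.card) :
    {n : ℕ | ∀ i ∈ Finset.Icc 1 k, ∃ j ∈ Finset.Icc 1 k, j ≠ i ∧
        1 < Int.gcd (f.eval ((n + i : ℕ) : ℤ)) (f.eval ((n + j : ℕ) : ℤ))}.Infinite := by
  classical
  obtain ⟨c₁, h₁⟩ := exists_card_sdiff_biUnion_coveredBy_le S hS R hR
  obtain ⟨c₂, h₂⟩ := exists_subset_biUnion_coveredBy T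
    (R \ S.biUnion fun p => coveredBy f k p (c₁ p)) (Finset.sdiff_subset.trans hR)
    (by exact_mod_cast h₁.trans hcard) (fun p hp => (hT p hp).2)
  refine infinite_of_covering hf (M ∪ S ∪ T) ?_
    (fun p => if p ∈ M then c₀ p else if p ∈ S then c₁ p else c₂ p) ?_
  · intro p hp
    simp only [Finset.mem_union] at hp
    rcases hp with (hp | hp) | hp
    exacts [hM p hp, (hS p hp).1, (hT p hp).1]
  · intro i hi
    by_cases hiR : i ∈ R
    · by_cases hiS : i ∈ S.biUnion fun p => coveredBy f k p (c₁ p)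
      · obtain ⟨p, hp, hip⟩ := Finset.mem_biUnion.mp hiS
        refine ⟨p, by simp [hp], ?_⟩
        rwa [if_neg (Finset.disjoint_right.mp hMS hp), if_pos hp]
      · obtain ⟨p, hp, hip⟩ := h₂ i (Finset.mem_sdiff.mpr ⟨hiR, hiS⟩)
        refine ⟨p, by simp [hp], ?_⟩
        rwa [if_neg (Finset.disjoint_right.mp hMT hp), if_neg (Finset.disjoint_right.mp hST hp)]
    · obtain ⟨p, hp, hip⟩ := hRM i hi hiR
      exact ⟨p, by simp [hp], by rwa [if_pos hp]⟩

theorem pow_dvd_sub_of_dvd_sub {P : ℤ[X]} {p : ℕ} (hp : p.Prime) {e : ℕ} {s t : ℤ}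
    (ht : ¬ (p : ℤ) ∣ P.derivative.eval t) (hPs : (p : ℤ) ^ e ∣ P.eval s)
    (hPt : (p : ℤ) ^ e ∣ P.eval t) (hst : (p : ℤ) ∣ s - t) : (p : ℤ) ^ e ∣ s - t := by
  obtain ⟨z, hz⟩ := P.binomExpansion t (s - t)
  rw [add_sub_cancel] at hz
  have h1 : (p : ℤ) ^ e ∣ (P.derivative.eval t + z * (s - t)) * (s - t) := by
    have : (P.derivative.eval t + z * (s - t)) * (s - t) = P.eval s - P.eval t := by
      rw [hz]; ring
    rw [this]
    exact dvd_sub hPs hPt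
  refine IsCoprime.dvd_of_dvd_mul_left (IsCoprime.pow_left ?_) h1
  rw [Prime.coprime_iff_not_dvd (Nat.prime_iff_prime_int.mp hp)]
  intro h
  exact ht ((dvd_add_left (hst.mul_left z)).mp h)

theorem card_filter_pow_dvd_eval_le {P : ℤ[X]} {p : ℕ} (hp : p.Prime)
    (hP0 : ¬ (p : ℤ) ∣ P.eval 0)
    (hP : ∀ t : ℤ, (p : ℤ) ∣ P.eval t → ¬ (p : ℤ) ∣ P.derivative.eval t)
    {e : ℕ} (he : 0 < e) (X : ℕ) :
    ((Finset.Icc 1 X).filter fun t : ℕ => p ^ e ∣ (P.eval (t : ℤ)).natAbs).card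
      ≤ (X / p ^ e + 1) * P.natDegree := by
  have : Fact p.Prime := ⟨hp⟩
  set Q := P.map (Int.castRingHom (ZMod p)) with hQ
  have heval : ∀ t : ℤ, Q.eval (t : ZMod p) = ((P.eval t : ℤ) : ZMod p) := by
    intro t
    rw [hQ, eval_intCast_map]
    simp
  have hQ0 : Q ≠ 0 := by
    intro h
    apply hP0
    have := heval 0
    rw [h, eval_zero] at this
    exact (ZMod.intCast_zmod_eq_zero_iff_dvd _ p).mp this.symm
  have hcard : Q.roots.toFinset.card ≤ P.natDegree :=
    (Multiset.toFinset_card_le _).trans ((card_roots' Q).trans natDegree_map_le)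
  have hdvd : ∀ t : ℕ, p ^ e ∣ (P.eval (t : ℤ)).natAbs → (p : ℤ) ^ e ∣ P.eval (t : ℤ) := by
    intro t ht
    have := Int.natCast_dvd_natCast.mpr ht
    rw [Int.dvd_natAbs] at this
    exact_mod_cast this
  refine (Finset.card_le_mul_card_image_of_maps_to (f := fun t : ℕ => (t : ZMod p))
    (t := Q.roots.toFinset) ?_ (X / p ^ e + 1) ?_).trans (Nat.mul_le_mul_left _ hcard)
  · intro t ht
    rw [Finset.mem_filter] at ht
    rw [Multiset.mem_toFinset, mem_roots hQ0, IsRoot.def]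
    have h1 := heval t
    rw [Int.cast_natCast] at h1
    rw [h1, ZMod.intCast_zmod_eq_zero_iff_dvd]
    exact (dvd_pow_self _ he.ne').trans (hdvd t ht.2)
  · intro r _
    rw [← Finset.card_range (X / p ^ e + 1)]
    refine Finset.card_le_card_of_injOn (fun t => t / p ^ e) ?_ ?_
    · intro t ht
      simp only [Finset.coe_filter, Finset.mem_filter, Finset.mem_Icc, Set.mem_ofPred_eq] at ht
      simp only [Finset.coe_range, Set.mem_Iio]
      exact Nat.lt_succ_of_le (Nat.div_le_div_right ht.1.1.2)
    · intro s hs t ht hst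
      simp only [Finset.coe_filter, Finset.mem_filter, Finset.mem_Icc, Set.mem_ofPred_eq] at hs ht
      have h1 : (p : ℤ) ∣ (s : ℤ) - t := by
        rw [← ZMod.intCast_zmod_eq_zero_iff_dvd]
        push_cast
        rw [hs.2, ht.2, sub_self]
      have h2 := pow_dvd_sub_of_dvd_sub hp
        (hP t ((dvd_pow_self _ he.ne').trans (hdvd t ht.1.2))) (hdvd s hs.1.2) (hdvd t ht.1.2) h1
      have h3 : t % p ^ e = s % p ^ e := by
        have : (t : ℤ) ≡ s [ZMOD ((p ^ e : ℕ) : ℤ)] := by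
          rw [Int.modEq_iff_dvd]
          exact_mod_cast h2
        exact Int.natCast_modEq_iff.mp this
      have h4 : s / p ^ e = t / p ^ e := hst
      rw [← Nat.div_add_mod s (p ^ e), ← Nat.div_add_mod t (p ^ e), h3, h4]

theorem card_filter_pow_dvd_eq_factorization {p n E : ℕ} (hp : p.Prime) (hn : n ≠ 0)
    (hE : n.factorization p ≤ E) :
    ((Finset.Icc 1 E).filter fun e => p ^ e ∣ n).card = n.factorization p := by
  have : ((Finset.Icc 1 E).filter fun e => p ^ e ∣ n) = Finset.Icc 1 (n.factorization p) := by
    ext e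
    simp only [Finset.mem_filter, Finset.mem_Icc, hp.pow_dvd_iff_le_factorization hn]
    omega
  rw [this, Nat.card_Icc, Nat.add_sub_cancel]

theorem sum_Icc_one_div_pow_le {p : ℕ} (hp : 2 ≤ p) (E : ℕ) :
    ∑ e ∈ Finset.Icc 1 E, (1 : ℝ) / p ^ e ≤ 1 / (p - 1) := by
  have hp' : (2 : ℝ) ≤ p := by exact_mod_cast hp
  have h : ∀ E : ℕ, ∑ e ∈ Finset.Icc 1 E, (1 : ℝ) / p ^ e =
      1 / (p - 1) - 1 / ((p - 1) * p ^ E) := by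
    intro E
    have h1 : (p : ℝ) - 1 ≠ 0 := by linarith
    have h2 : (p : ℝ) ≠ 0 := by linarith
    induction E with
    | zero => simp
    | succ n ih =>
      rw [Finset.sum_Icc_succ_top (by omega), ih]
      field_simp
      ring
  rw [h]
  have : 0 ≤ 1 / (((p : ℝ) - 1) * p ^ E) := by
    have : (0 : ℝ) ≤ p - 1 := by linarith
    positivity
  linarith

/-- The prime factors exceeding `X` of the values `P 1, …, P X`. -/
noncomputable def largePrimeFactors (P : ℤ[X]) (X : ℕ) : Finset ℕ :=
  (Finset.Icc 1 X).biUnion fun t => (P.eval (t : ℤ)).natAbs.primeFactors.filter fun p => X < p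

theorem sum_factorization_le {P : ℤ[X]} {p X B : ℕ} (hp : p.Prime)
    (hP0 : ¬ (p : ℤ) ∣ P.eval 0)
    (hP : ∀ t : ℤ, (p : ℤ) ∣ P.eval t → ¬ (p : ℤ) ∣ P.derivative.eval t)
    (hne : ∀ t ∈ Finset.Icc 1 X, P.eval (t : ℤ) ≠ 0)
    (hB : ∀ t ∈ Finset.Icc 1 X, (P.eval (t : ℤ)).natAbs ≤ B) :
    (∑ t ∈ Finset.Icc 1 X, ((P.eval (t : ℤ)).natAbs.factorization p : ℝ)) * Real.log p
      ≤ P.natDegree * (X * Real.log p / (p - 1) + Real.log B) := by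
  rcases Nat.eq_zero_or_pos X with rfl | hX
  · simp only [zero_lt_one, Finset.Icc_eq_empty_of_lt, Finset.sum_empty, zero_mul,
      CharP.cast_eq_zero, zero_div, zero_add]
    have := Real.log_natCast_nonneg B
    positivity
  have hB0 : B ≠ 0 := by
    have h1 := hne 1 (by simp; omega)
    have h2 := hB 1 (by simp; omega)
    rintro rfl
    exact h1 (Int.natAbs_eq_zero.mp (Nat.le_zero.mp h2))
  set E := Nat.log p B
  have hlogp : 0 ≤ Real.log p := Real.log_natCast_nonneg p
  have hval : ∀ t ∈ Finset.Icc 1 X, (P.eval (t : ℤ)).natAbs.factorization p ≤ E := by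
    intro t ht
    have h0 : (P.eval (t : ℤ)).natAbs ≠ 0 := Int.natAbs_ne_zero.mpr (hne t ht)
    refine Nat.le_log_of_pow_le hp.one_lt
      ((Nat.le_of_dvd (Nat.pos_of_ne_zero h0) ?_).trans (hB t ht))
    exact Nat.ordProj_dvd _ _
  have hsum : ∑ t ∈ Finset.Icc 1 X, (P.eval (t : ℤ)).natAbs.factorization p
      = ∑ e ∈ Finset.Icc 1 E,
        ((Finset.Icc 1 X).filter fun t : ℕ => p ^ e ∣ (P.eval (t : ℤ)).natAbs).card := by
    rw [Finset.sum_congr rfl fun t ht => (card_filter_pow_dvd_eq_factorization hp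
      (Int.natAbs_ne_zero.mpr (hne t ht)) (hval t ht)).symm]
    simp only [Finset.card_filter]
    exact Finset.sum_comm
  have hterm : ∀ e ∈ Finset.Icc 1 E,
      (((Finset.Icc 1 X).filter fun t : ℕ => p ^ e ∣ (P.eval (t : ℤ)).natAbs).card : ℝ)
        ≤ P.natDegree * (X * (1 / (p : ℝ) ^ e) + 1) := by
    intro e he
    have h1 := card_filter_pow_dvd_eval_le hp hP0 hP (Finset.mem_Icc.mp he).1 X
    have h2 : ((X / p ^ e : ℕ) : ℝ) ≤ X * (1 / (p : ℝ) ^ e) := by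
      have := @Nat.cast_div_le ℝ _ _ _ X (p ^ e)
      rw [mul_one_div]
      exact_mod_cast this
    calc _ ≤ (((X / p ^ e + 1) * P.natDegree : ℕ) : ℝ) := by exact_mod_cast h1
      _ = P.natDegree * (((X / p ^ e : ℕ) : ℝ) + 1) := by push_cast; ring
      _ ≤ _ := by gcongr
  have hE : E * Real.log p ≤ Real.log B := by
    rw [← Real.log_pow]
    apply Real.log_le_log (by have := hp.pos; positivity)
    exact_mod_cast Nat.pow_log_le_self p hB0
  have hgeo := sum_Icc_one_div_pow_le hp.two_le E
  calc _ = (((∑ t ∈ Finset.Icc 1 X, (P.eval (t : ℤ)).natAbs.factorization p : ℕ) : ℝ))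
        * Real.log p := by push_cast; rfl
    _ ≤ (∑ e ∈ Finset.Icc 1 E, P.natDegree * (X * (1 / (p : ℝ) ^ e) + 1)) * Real.log p := by
        rw [hsum, Nat.cast_sum]
        exact mul_le_mul_of_nonneg_right (Finset.sum_le_sum hterm) hlogp
    _ = P.natDegree * (X * (∑ e ∈ Finset.Icc 1 E, 1 / (p : ℝ) ^ e) * Real.log p
          + E * Real.log p) := by
        rw [← Finset.mul_sum, Finset.sum_add_distrib, ← Finset.mul_sum]
        simp
        ring
    _ ≤ P.natDegree * (X * (1 / ((p : ℝ) - 1)) * Real.log p + Real.log B) := by gcongr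
    _ = _ := by ring

theorem sum_log_natAbs_eval_le {P : ℤ[X]} {S : Set ℕ} {X B : ℕ}
    (hS : ∀ (t : ℤ) (p : ℕ), p.Prime → (p : ℤ) ∣ P.eval t →
      p ∈ S ∧ ¬ (p : ℤ) ∣ P.derivative.eval t ∧ ¬ (p : ℤ) ∣ P.eval 0)
    (hne : ∀ t ∈ Finset.Icc 1 X, P.eval (t : ℤ) ≠ 0)
    (hB : ∀ t ∈ Finset.Icc 1 X, (P.eval (t : ℤ)).natAbs ≤ B) :
    open Classical in
    ∑ t ∈ Finset.Icc 1 X, Real.log (P.eval (t : ℤ)).natAbs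
      ≤ ∑ p ∈ (Nat.primesLE X).filter (· ∈ S),
          P.natDegree * (X * Real.log p / (p - 1) + Real.log B)
        + (largePrimeFactors P X).card * (P.natDegree * Real.log B) := by
  classical
  set F : ℕ → ℕ := fun t => (P.eval (t : ℤ)).natAbs with hF
  have hF0 : ∀ t ∈ Finset.Icc 1 X, F t ≠ 0 := fun t ht => Int.natAbs_ne_zero.mpr (hne t ht)
  have hdvd : ∀ {p t : ℕ}, p ∣ F t → (p : ℤ) ∣ P.eval (t : ℤ) := fun h =>
    Int.natCast_dvd.mpr h
  have hlogB : 0 ≤ Real.log B := Real.log_natCast_nonneg B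
  have hlog : ∀ t ∈ Finset.Icc 1 X, Real.log (F t) =
      ∑ p ∈ (F t).primeFactors.filter (· ≤ X), (F t).factorization p * Real.log p
      + ∑ p ∈ (F t).primeFactors.filter (X < ·), (F t).factorization p * Real.log p := by
    intro t _
    rw [Real.log_nat_eq_sum_factorization, Finsupp.sum, Nat.support_factorization]
    simp only [← not_le]
    exact (Finset.sum_filter_add_sum_filter_not _ _ _).symm
  have hsmall : ∑ t ∈ Finset.Icc 1 X,
      ∑ p ∈ (F t).primeFactors.filter (· ≤ X), (F t).factorization p * Real.log p
      ≤ ∑ p ∈ (Nat.primesLE X).filter (· ∈ S),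
          P.natDegree * (X * Real.log p / (p - 1) + Real.log B) := by
    calc _ ≤ ∑ t ∈ Finset.Icc 1 X, ∑ p ∈ (Nat.primesLE X).filter
            (fun p => ∃ s ∈ Finset.Icc 1 X, p ∣ F s), (F t).factorization p * Real.log p := by
          refine Finset.sum_le_sum fun t ht => Finset.sum_le_sum_of_subset_of_nonneg ?_ ?_
          · intro p hp
            simp only [Finset.mem_filter, Nat.mem_primeFactors] at hp
            simp only [Finset.mem_filter, Nat.mem_primesLE]
            exact ⟨⟨hp.2, hp.1.1⟩, t, ht, hp.1.2.1⟩
          · intro p _ _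
            have := Real.log_natCast_nonneg p
            positivity
      _ = ∑ p ∈ (Nat.primesLE X).filter (fun p => ∃ s ∈ Finset.Icc 1 X, p ∣ F s),
            (∑ t ∈ Finset.Icc 1 X, ((F t).factorization p : ℝ)) * Real.log p := by
          rw [Finset.sum_comm]
          simp only [Finset.sum_mul]
      _ ≤ ∑ p ∈ (Nat.primesLE X).filter (fun p => ∃ s ∈ Finset.Icc 1 X, p ∣ F s),
          P.natDegree * (X * Real.log p / (p - 1) + Real.log B) := by
          refine Finset.sum_le_sum fun p hp => ?_
          simp only [Finset.mem_filter, Nat.mem_primesLE] at hp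
          obtain ⟨⟨-, hp⟩, s, -, hs⟩ := hp
          exact sum_factorization_le hp (hS s p hp (hdvd hs)).2.2
            (fun t ht => (hS t p hp ht).2.1) hne hB
      _ ≤ _ := by
          refine Finset.sum_le_sum_of_subset_of_nonneg ?_ ?_
          · intro p hp
            simp only [Finset.mem_filter, Nat.mem_primesLE] at hp ⊢
            obtain ⟨⟨hpX, hp⟩, s, -, hs⟩ := hp
            exact ⟨⟨hpX, hp⟩, (hS s p hp (hdvd hs)).1⟩
          · intro p hp _
            simp only [Finset.mem_filter, Nat.mem_primesLE] at hp
            have h1 := Real.log_natCast_nonneg p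
            have h2 : (0 : ℝ) ≤ p - 1 := by
              have : (1 : ℝ) ≤ p := by exact_mod_cast hp.1.2.one_lt.le
              linarith
            positivity
  have hlarge : ∑ t ∈ Finset.Icc 1 X,
      ∑ p ∈ (F t).primeFactors.filter (X < ·), (F t).factorization p * Real.log p
      ≤ (largePrimeFactors P X).card * (P.natDegree * Real.log B) := by
    calc _ ≤ ∑ t ∈ Finset.Icc 1 X, ∑ p ∈ (largePrimeFactors P X).filter (· ∣ F t),
            Real.log B := by
          refine Finset.sum_le_sum fun t ht => ?_
          have hsub : (F t).primeFactors.filter (X < ·)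
              ⊆ (largePrimeFactors P X).filter (· ∣ F t) := by
            intro p hp
            refine Finset.mem_filter.mpr ⟨Finset.mem_biUnion.mpr ⟨t, ht, hp⟩, ?_⟩
            exact Nat.dvd_of_mem_primeFactors (Finset.mem_filter.mp hp).1
          refine (Finset.sum_le_sum fun p hp => ?_).trans
            (Finset.sum_le_sum_of_subset_of_nonneg hsub fun _ _ _ => hlogB)
          have hpp := Nat.prime_of_mem_primeFactors (Finset.mem_filter.mp hp).1
          rw [← Real.log_pow]
          apply Real.log_le_log (by have := hpp.pos; positivity)
          have : p ^ (F t).factorization p ≤ F t :=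
            Nat.le_of_dvd (Nat.pos_of_ne_zero (hF0 t ht)) (Nat.ordProj_dvd _ _)
          exact_mod_cast this.trans (hB t ht)
      _ = ∑ p ∈ largePrimeFactors P X,
            (((Finset.Icc 1 X).filter fun t => p ∣ F t).card : ℝ) * Real.log B := by
          simp only [Finset.sum_filter, Finset.card_filter, Nat.cast_sum, Finset.sum_mul]
          rw [Finset.sum_comm]
          simp
      _ ≤ ∑ p ∈ largePrimeFactors P X, P.natDegree * Real.log B := by
          refine Finset.sum_le_sum fun p hp => ?_
          obtain ⟨s, -, hps⟩ := Finset.mem_biUnion.mp hp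
          rw [Finset.mem_filter] at hps
          have hpp := Nat.prime_of_mem_primeFactors hps.1
          have hpd := hdvd (Nat.dvd_of_mem_primeFactors hps.1)
          have h := card_filter_pow_dvd_eval_le hpp (hS s p hpp hpd).2.2
            (fun t ht => (hS t p hpp ht).2.1) one_pos X
          rw [pow_one, Nat.div_eq_of_lt hps.2, zero_add, one_mul] at h
          gcongr
      _ = _ := by rw [Finset.sum_const, nsmul_eq_mul]
  rw [Finset.sum_congr rfl hlog, Finset.sum_add_distrib]
  exact add_le_add hsmall hlarge

theorem Nat.card_primesLE (n : ℕ) : (Nat.primesLE n).card = Nat.primeCounting n := by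
  rw [Nat.primesLE, Nat.primesBelow_card_eq_primeCounting', Nat.primeCounting]

theorem eventually_primeCounting_le_mul {ε : ℝ} (hε : 0 < ε) :
    ∀ᶠ n : ℕ in Filter.atTop, (Nat.primeCounting n : ℝ) ≤ ε * n := by
  have h1 := tendsto_natCast_atTop_atTop.eventually
    (Chebyshev.eventually_primeCounting_le one_pos)
  have h2 := (Real.tendsto_log_atTop.comp tendsto_natCast_atTop_atTop).eventually
    (Filter.eventually_ge_atTop ((Real.log 4 + 1) / ε))
  have h3 := (Real.tendsto_log_atTop.comp tendsto_natCast_atTop_atTop).eventually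
    (Filter.eventually_gt_atTop 0)
  filter_upwards [h1, h2, h3] with n h1 h2 h3
  simp only [Function.comp_apply, Nat.floor_natCast] at h1 h2 h3
  refine h1.trans ?_
  rw [div_le_iff₀ hε] at h2
  rw [div_le_iff₀ h3]
  calc (Real.log 4 + 1) * n ≤ Real.log n * ε * n := by gcongr
    _ = _ := by ring

theorem log_factorial_eq_sum (n : ℕ) :
    Real.log n.factorial = ∑ i ∈ Finset.Icc 1 n, Real.log i := by
  induction n with
  | zero => simp
  | succ n ih =>
    rw [Finset.sum_Icc_succ_top (by omega), Nat.factorial_succ, Nat.cast_mul,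
      Real.log_mul (by positivity) (by positivity), ih, add_comm]

theorem mul_log_sub_le_log_factorial (n : ℕ) :
    n * Real.log n - n ≤ Real.log n.factorial := by
  rcases Nat.eq_zero_or_pos n with rfl | hn
  · simp
  have hn' : (0 : ℝ) < n := by exact_mod_cast hn
  have h := Real.pow_div_factorial_le_exp (n : ℝ) hn'.le n
  have hf : (0 : ℝ) < n.factorial := by exact_mod_cast n.factorial_pos
  have h2 := Real.log_le_log (by positivity) h
  rw [Real.log_exp, Real.log_div (by positivity) hf.ne', Real.log_pow] at h2
  linarith

theorem exists_natAbs_eval_le_mul_pow (P : ℤ[X]) :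
    ∃ A : ℕ, ∀ t : ℕ, 1 ≤ t → (P.eval (t : ℤ)).natAbs ≤ A * t ^ P.natDegree := by
  refine ⟨∑ i ∈ Finset.range (P.natDegree + 1), (P.coeff i).natAbs, fun t ht => ?_⟩
  rw [eval_eq_sum_range]
  refine (Int.natAbs_sum_le _ _).trans ?_
  rw [Finset.sum_mul]
  refine Finset.sum_le_sum fun i hi => ?_
  rw [Int.natAbs_mul, Int.natAbs_pow, Int.natAbs_natCast]
  exact Nat.mul_le_mul_left _ (Nat.pow_le_pow_right ht (Nat.le_of_lt_succ (Finset.mem_range.mp hi)))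

theorem eventually_mul_le_card_largePrimeFactors {P : ℤ[X]} {S : Set ℕ} (hdeg : 0 < P.natDegree)
    (hS : ∀ (t : ℤ) (p : ℕ), p.Prime → (p : ℤ) ∣ P.eval t →
      p ∈ S ∧ ¬ (p : ℤ) ∣ P.derivative.eval t ∧ ¬ (p : ℤ) ∣ P.eval 0)
    (hS20 : ∀ p ∈ S, 20 ≤ p)
    (hlow : ∀ t : ℕ, 1 ≤ t → t ^ P.natDegree ≤ (P.eval (t : ℤ)).natAbs)
    (hlog : open Classical in ∀ᶠ X : ℕ in Filter.atTop,
      ∑ p ∈ (Nat.primesLE X).filter (· ∈ S), Real.log p / p ≤ 2 / 3 * Real.log X) :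
    ∃ c : ℝ, 0 < c ∧ ∀ᶠ X : ℕ in Filter.atTop, c * X ≤ (largePrimeFactors P X).card := by
  classical
  obtain ⟨A, hA⟩ := exists_natAbs_eval_le_mul_pow P
  set m := P.natDegree with hm
  have hm0 : (0 : ℝ) < m := by exact_mod_cast hdeg
  refine ⟨1 / (10 * (m + 1)), by positivity, ?_⟩
  have hπ := eventually_primeCounting_le_mul (ε := 1 / (20 * (m + 1))) (by positivity)
  have hlarge := (Real.tendsto_log_atTop.comp tendsto_natCast_atTop_atTop).eventually
    (Filter.eventually_ge_atTop 20)
  filter_upwards [hlog, hπ, hlarge, Filter.eventually_ge_atTop A,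
    Filter.eventually_ge_atTop 1] with X hlog hπ hL hXA hX1
  simp only [Function.comp_apply] at hL
  set L := Real.log X with hLdef
  have hX0 : (0 : ℝ) < X := by exact_mod_cast hX1
  have hne : ∀ t ∈ Finset.Icc 1 X, P.eval (t : ℤ) ≠ 0 := by
    intro t ht h
    have h1 := (Finset.mem_Icc.mp ht).1
    have h2 := hlow t h1
    rw [h, Int.natAbs_zero] at h2
    exact absurd h2 (not_le.mpr (pow_pos h1 m))
  have hB : ∀ t ∈ Finset.Icc 1 X, (P.eval (t : ℤ)).natAbs ≤ X ^ (m + 1) := by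
    intro t ht
    rw [Finset.mem_Icc] at ht
    calc _ ≤ A * t ^ m := hA t ht.1
      _ ≤ X * X ^ m := Nat.mul_le_mul hXA (Nat.pow_le_pow_left ht.2 m)
      _ = _ := by ring
  have hmain := sum_log_natAbs_eval_le hS hne hB
  have hlogB : Real.log ((X ^ (m + 1) : ℕ) : ℝ) = (m + 1) * L := by
    push_cast
    rw [Real.log_pow]
    push_cast
    rfl
  rw [hlogB, ← hm] at hmain
  have hlower : m * (X * L - X) ≤ ∑ t ∈ Finset.Icc 1 X, Real.log (P.eval (t : ℤ)).natAbs := by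
    calc m * (X * L - X) ≤ m * Real.log X.factorial := by
          gcongr
          exact mul_log_sub_le_log_factorial X
      _ = ∑ t ∈ Finset.Icc 1 X, m * Real.log t := by
          rw [← Finset.mul_sum, log_factorial_eq_sum]
      _ ≤ _ := by
          refine Finset.sum_le_sum fun t ht => ?_
          have h1 := (Finset.mem_Icc.mp ht).1
          rw [← Real.log_pow]
          apply Real.log_le_log (by positivity)
          exact_mod_cast hlow t h1
  have hsmall : ∑ p ∈ (Nat.primesLE X).filter (· ∈ S),
      (m * (X * Real.log p / (p - 1) + (m + 1) * L) : ℝ) ≤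
        m * (71 / 100 * (X * L) + X * L / 20) := by
    rw [← Finset.mul_sum, Finset.sum_add_distrib]
    gcongr
    · calc _ ≤ ∑ p ∈ (Nat.primesLE X).filter (· ∈ S), 20 / 19 * X * (Real.log p / p) := by
            refine Finset.sum_le_sum fun p hp => ?_
            have h20 : (20 : ℝ) ≤ p := by exact_mod_cast hS20 p (Finset.mem_filter.mp hp).2
            have hl := Real.log_natCast_nonneg p
            rw [div_le_iff₀ (by linarith)]
            have h1 : (1 : ℝ) ≤ 20 / 19 * ((p - 1) / p) := by
              rw [← mul_div_assoc, le_div_iff₀ (by linarith)]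
              linarith
            calc X * Real.log p = X * Real.log p * 1 := by ring
              _ ≤ X * Real.log p * (20 / 19 * ((p - 1) / p)) := by gcongr
              _ = _ := by ring
        _ ≤ 20 / 19 * X * (2 / 3 * L) := by
            rw [← Finset.mul_sum]
            gcongr
        _ ≤ _ := by nlinarith [mul_pos hX0 (show 0 < L by linarith)]
    · rw [Finset.sum_const, nsmul_eq_mul]
      have h1 : (((Nat.primesLE X).filter (· ∈ S)).card : ℝ) ≤ 1 / (20 * (m + 1)) * X := by
        refine le_trans ?_ hπ
        rw [← Nat.card_primesLE]
        exact_mod_cast Finset.card_filter_le _ _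
      calc _ ≤ 1 / (20 * ((m : ℝ) + 1)) * X * ((m + 1) * L) := by gcongr
        _ = _ := by field_simp
  have hfinal : m * (X * L - X) ≤ m * (71 / 100 * (X * L) + X * L / 20)
      + (largePrimeFactors P X).card * (m * ((m + 1) * L)) :=
    hlower.trans (hmain.trans (by linarith))
  have h1 : X * L - X ≤ 71 / 100 * (X * L) + X * L / 20
      + (largePrimeFactors P X).card * ((m + 1) * L) := by
    refine le_of_mul_le_mul_left (hfinal.trans_eq ?_) hm0
    ring
  have h2 : (X : ℝ) ≤ X * L / 20 := by nlinarith
  have h3 : X * (1 / 10) * L ≤ (largePrimeFactors P X).card * (m + 1) * L := by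
    nlinarith [mul_pos hX0 (show 0 < L by linarith)]
  have h4 := le_of_mul_le_mul_right h3 (by linarith)
  rw [div_mul_eq_mul_div, one_mul, div_le_iff₀ (by positivity)]
  linarith

section

open Filter Topology

variable (K : Type*) [Field K] [NumberField K]

/-- The nonzero ideals of `𝓞 K` of norm at most `n`. -/
noncomputable def idealsLE (n : ℕ) : Finset (Ideal (𝓞 K)) :=
  open Classical in (Ideal.finite_setOfPred_absNorm_le n).toFinset.filter (· ≠ 0)

variable {K}

theorem mem_idealsLE {n : ℕ} {I : Ideal (𝓞 K)} :
    I ∈ idealsLE K n ↔ Ideal.absNorm I ≤ n ∧ I ≠ 0 := by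
  simp [idealsLE]

theorem absNorm_pos_of_ne_zero {I : Ideal (𝓞 K)} (hI : I ≠ 0) : 0 < Ideal.absNorm I :=
  Nat.pos_of_ne_zero fun h => hI (Ideal.absNorm_eq_zero_iff.mp h)

theorem card_filter_dvd_idealsLE [DecidableEq (Ideal (𝓞 K))] {P : Ideal (𝓞 K)} (hP : P ≠ 0)
    (n : ℕ) : open Classical in
    ((idealsLE K n).filter (P ∣ ·)).card = (idealsLE K (n / Ideal.absNorm P)).card := by
  classical
  symm
  refine Finset.card_bij (fun I _ => P * I) ?_ ?_ ?_
  · intro I hI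
    rw [mem_idealsLE, Nat.le_div_iff_mul_le (absNorm_pos_of_ne_zero hP)] at hI
    rw [Finset.mem_filter, mem_idealsLE, map_mul, mul_comm (Ideal.absNorm P)]
    exact ⟨⟨hI.1, mul_ne_zero hP hI.2⟩, dvd_mul_right _ _⟩
  · intro I _ J _ h
    exact mul_left_cancel₀ hP h
  · intro J hJ
    rw [Finset.mem_filter, mem_idealsLE] at hJ
    obtain ⟨⟨h1, h2⟩, I, rfl⟩ := hJ
    refine ⟨I, ?_, rfl⟩
    rw [mem_idealsLE, Nat.le_div_iff_mul_le (absNorm_pos_of_ne_zero hP)]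
    rw [map_mul, mul_comm] at h1
    exact ⟨h1, right_ne_zero_of_mul h2⟩

theorem tendsto_card_idealsLE_div :
    Tendsto (fun s : ℝ => ((idealsLE K ⌊s⌋₊).card : ℝ) / s) atTop
      (𝓝 (dedekindZeta_residue K)) := by
  refine (Ideal.tendsto_norm_le_div_atTop₀ K).congr' ?_
  filter_upwards [eventually_ge_atTop 0] with s hs
  congr 2
  rw [← Nat.card_eq_finsetCard]
  refine Nat.card_congr ((Equiv.subtypeSubtypeEquivSubtypeInter (· ∈ nonZeroDivisors (Ideal (𝓞 K)))
    fun I => (Ideal.absNorm I : ℝ) ≤ s).trans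
    (Equiv.subtypeEquivRight (q := (· ∈ idealsLE K ⌊s⌋₊)) fun I => ?_))
  rw [mem_idealsLE, Nat.le_floor_iff hs, mem_nonZeroDivisors_iff_ne_zero, and_comm]

theorem eventually_card_idealsLE_bounds {ε : ℝ} (hε : 0 < ε) :
    ∀ᶠ s : ℝ in atTop,
      (1 - ε) * dedekindZeta_residue K * s ≤ (idealsLE K ⌊s⌋₊).card ∧
      ((idealsLE K ⌊s⌋₊).card : ℝ) ≤ (1 + ε) * dedekindZeta_residue K * s := by
  have hκ := dedekindZeta_residue_pos K
  have h1 := (tendsto_card_idealsLE_div (K := K)).eventually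
    (Icc_mem_nhds (a := (1 - ε) * dedekindZeta_residue K) (b := (1 + ε) * dedekindZeta_residue K)
      (by nlinarith) (by nlinarith))
  filter_upwards [h1, eventually_gt_atTop 0] with s hs hs0
  exact ⟨(le_div_iff₀ hs0).mp hs.1, (div_le_iff₀ hs0).mp hs.2⟩

theorem sum_log_absNorm_le {I : Ideal (𝓞 K)} (hI : I ≠ 0) {Q : Finset (Ideal (𝓞 K))}
    (hQ : ∀ P ∈ Q, Prime P) (hdvd : ∀ P ∈ Q, P ∣ I) :
    ∑ P ∈ Q, Real.log (Ideal.absNorm P) ≤ Real.log (Ideal.absNorm I) := by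
  have h := map_dvd Ideal.absNorm (Finset.prod_primes_dvd I hQ hdvd)
  rw [map_prod] at h
  have hpos : ∀ P ∈ Q, (Ideal.absNorm P : ℝ) ≠ 0 := fun P hP => by
    exact_mod_cast (absNorm_pos_of_ne_zero (hQ P hP).ne_zero).ne'
  rw [← Real.log_prod hpos]
  apply Real.log_le_log
  · exact Finset.prod_pos fun P hP => lt_of_le_of_ne (Nat.cast_nonneg _) (hpos P hP).symm
  · exact_mod_cast Nat.le_of_dvd (absNorm_pos_of_ne_zero hI) h

theorem sum_log_absNorm_mul_card_le {Q : Finset (Ideal (𝓞 K))} (hQ : ∀ P ∈ Q, Prime P) (n : ℕ) :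
    ∑ P ∈ Q, Real.log (Ideal.absNorm P) * (idealsLE K (n / Ideal.absNorm P)).card
      ≤ (idealsLE K n).card * Real.log n := by
  classical
  calc ∑ P ∈ Q, Real.log (Ideal.absNorm P) * (idealsLE K (n / Ideal.absNorm P)).card
      = ∑ P ∈ Q, ∑ I ∈ idealsLE K n, if P ∣ I then Real.log (Ideal.absNorm P) else 0 := by
        refine Finset.sum_congr rfl fun P hP => ?_
        rw [← Finset.sum_filter, Finset.sum_const, card_filter_dvd_idealsLE (hQ P hP).ne_zero,
          nsmul_eq_mul, mul_comm]
    _ = ∑ I ∈ idealsLE K n, ∑ P ∈ Q with P ∣ I, Real.log (Ideal.absNorm P) := by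
        rw [Finset.sum_comm]
        exact Finset.sum_congr rfl fun I _ => (Finset.sum_filter _ _).symm
    _ ≤ ∑ I ∈ idealsLE K n, Real.log n := by
        refine Finset.sum_le_sum fun I hI => ?_
        rw [mem_idealsLE] at hI
        refine (sum_log_absNorm_le hI.2 (fun P hP => hQ P (Finset.mem_of_mem_filter P hP))
          fun P hP => (Finset.mem_filter.mp hP).2).trans ?_
        apply Real.log_le_log
        · exact_mod_cast absNorm_pos_of_ne_zero hI.2
        · exact_mod_cast hI.1
    _ = _ := by rw [Finset.sum_const, nsmul_eq_mul]

theorem prime_of_prime_absNorm {P : Ideal (𝓞 K)} (h : (Ideal.absNorm P).Prime) : Prime P :=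
  Ideal.prime_of_isPrime (fun h0 => by simp [h0] at h; exact absurd h Nat.not_prime_zero)
    (Ideal.isPrime_of_irreducible_absNorm h)

theorem eventually_sum_log_div_le {S : Set ℕ}
    (hS : ∀ p ∈ S, p.Prime ∧ ∃ P Q : Ideal (𝓞 K), P ≠ Q ∧ Ideal.absNorm P = p ∧
      Ideal.absNorm Q = p) :
    open Classical in ∀ᶠ y : ℕ in atTop,
      ∑ p ∈ (Nat.primesLE y).filter (· ∈ S), Real.log p / p ≤ 2 / 3 * Real.log y := by
  classical
  have hκ := dedekindZeta_residue_pos K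
  set κ := dedekindZeta_residue K
  obtain ⟨s₀, hs₀⟩ := eventually_atTop.mp
    (eventually_card_idealsLE_bounds (K := K) (show (0 : ℝ) < 1 / 20 by norm_num))
  obtain ⟨t₀, ht₀⟩ := exists_nat_ge (max s₀ 1)
  have ht1 : (1 : ℝ) ≤ t₀ := (le_max_right _ _).trans ht₀
  have hbd : ∀ s : ℝ, t₀ ≤ s → _ := fun s hs => hs₀ s (((le_max_left _ _).trans ht₀).trans hs)
  have hlarge := (Real.tendsto_log_atTop.comp tendsto_natCast_atTop_atTop).eventually
    (eventually_ge_atTop (100 * Real.log t₀))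
  filter_upwards [hlarge, eventually_ge_atTop 1] with y hy hy1
  simp only [Function.comp_apply] at hy
  have hy1' : (1 : ℝ) ≤ y := by exact_mod_cast hy1
  set Q := (idealsLE K y).filter fun P => Ideal.absNorm P ∈ S with hQ
  have hQp : ∀ P ∈ Q, (Ideal.absNorm P).Prime := fun P hP => (hS _ (Finset.mem_filter.mp hP).2).1
  have hQle : ∀ P ∈ Q, Ideal.absNorm P ≤ y := fun P hP =>
    (mem_idealsLE.mp (Finset.mem_filter.mp hP).1).1
  have h1 := sum_log_absNorm_mul_card_le (fun P hP => prime_of_prime_absNorm (hQp P hP)) (t₀ * y)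
  have hx := (hbd (t₀ * y) (by nlinarith)).2
  have hfl : ⌊(t₀ * y : ℝ)⌋₊ = t₀ * y := by exact_mod_cast Nat.floor_natCast (t₀ * y)
  rw [hfl] at hx
  have hlogx : Real.log ((t₀ * y : ℕ) : ℝ) = Real.log t₀ + Real.log y := by
    rw [Nat.cast_mul, Real.log_mul (by linarith) (by linarith)]
  have hlogt : 0 ≤ Real.log t₀ := Real.log_nonneg ht1
  have hlogy : 0 ≤ Real.log y := Real.log_nonneg hy1'
  have h2 : ∑ P ∈ Q, Real.log (Ideal.absNorm P) / Ideal.absNorm P * ((1 - 1 / 20) * κ * (t₀ * y))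
      ≤ (1 + 1 / 20) * κ * (t₀ * y) * (Real.log t₀ + Real.log y) := by
    calc _ ≤ ∑ P ∈ Q, Real.log (Ideal.absNorm P) *
            (idealsLE K (t₀ * y / Ideal.absNorm P)).card := by
          refine Finset.sum_le_sum fun P hP => ?_
          have hp := (hQp P hP).pos
          have hp' : (0 : ℝ) < Ideal.absNorm P := by exact_mod_cast hp
          have hle : (Ideal.absNorm P : ℝ) ≤ y := by exact_mod_cast hQle P hP
          have h3 := (hbd (t₀ * y / Ideal.absNorm P) (by
            rw [le_div_iff₀ hp']
            gcongr)).1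
          have h4 : ⌊(t₀ * y / Ideal.absNorm P : ℝ)⌋₊ = t₀ * y / Ideal.absNorm P := by
            rw [Nat.floor_div_natCast, hfl]
          rw [h4] at h3
          have := Real.log_natCast_nonneg (Ideal.absNorm P)
          calc _ = Real.log (Ideal.absNorm P) *
                ((1 - 1 / 20) * κ * (t₀ * y / Ideal.absNorm P)) := by ring
            _ ≤ _ := by gcongr
      _ ≤ _ := h1
      _ ≤ _ := by
          rw [hlogx]
          gcongr
  rw [← Finset.sum_mul] at h2
  have h3 : ∑ P ∈ Q, Real.log (Ideal.absNorm P) / Ideal.absNorm P * (1 - 1 / 20)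
      ≤ (1 + 1 / 20) * (Real.log t₀ + Real.log y) := by
    have hpos : 0 < κ * (t₀ * y) := by positivity
    rw [← Finset.sum_mul]
    refine le_of_mul_le_mul_right (le_trans (le_of_eq ?_) (h2.trans_eq ?_)) hpos <;> ring
  rw [← Finset.sum_mul] at h3
  have h4 : 2 * ∑ p ∈ (Nat.primesLE y).filter (· ∈ S), Real.log p / p
      ≤ ∑ P ∈ Q, Real.log (Ideal.absNorm P) / Ideal.absNorm P := by
    have hmaps : ∀ P ∈ Q, Ideal.absNorm P ∈ (Nat.primesLE y).filter (· ∈ S) := by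
      intro P hP
      rw [Finset.mem_filter, Nat.mem_primesLE]
      exact ⟨⟨hQle P hP, hQp P hP⟩, (Finset.mem_filter.mp hP).2⟩
    rw [← Finset.sum_fiberwise_of_maps_to hmaps, Finset.mul_sum]
    refine Finset.sum_le_sum fun p hp => ?_
    rw [Finset.mem_filter, Nat.mem_primesLE] at hp
    obtain ⟨-, P₁, P₂, hne, hP₁, hP₂⟩ := hS p hp.2
    have hsub : {P₁, P₂} ⊆ Q.filter fun P => Ideal.absNorm P = p := by
      intro P hP
      have hPp : Ideal.absNorm P = p := by
        rw [Finset.mem_insert, Finset.mem_singleton] at hP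
        rcases hP with rfl | rfl <;> assumption
      have hpr : (Ideal.absNorm P).Prime := hPp ▸ hp.1.2
      rw [Finset.mem_filter, hQ, Finset.mem_filter, mem_idealsLE]
      exact ⟨⟨⟨hPp.trans_le hp.1.1, (prime_of_prime_absNorm hpr).ne_zero⟩, hPp ▸ hp.2⟩, hPp⟩
    have hcard := Finset.card_le_card hsub
    rw [Finset.card_pair hne] at hcard
    have hcard' : (2 : ℝ) ≤ (Q.filter fun P => Ideal.absNorm P = p).card := by exact_mod_cast hcard
    have hnn : 0 ≤ Real.log p / p := div_nonneg (Real.log_natCast_nonneg p) (Nat.cast_nonneg p)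
    calc 2 * (Real.log p / p) ≤
            (Q.filter fun P => Ideal.absNorm P = p).card * (Real.log p / p) := by
          gcongr
      _ = ∑ P ∈ Q with Ideal.absNorm P = p, Real.log p / p := by
          rw [Finset.sum_const, nsmul_eq_mul]
      _ = _ := Finset.sum_congr rfl fun P hP => by rw [(Finset.mem_filter.mp hP).2]
  linarith

theorem two_le_absNorm_of_prime {P : Ideal (𝓞 K)} (hP : Prime P) : 2 ≤ Ideal.absNorm P := by
  have h1 := absNorm_pos_of_ne_zero hP.ne_zero
  have h2 : Ideal.absNorm P ≠ 1 := fun h =>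
    hP.not_isUnit (Ideal.isUnit_iff.mpr (Ideal.absNorm_eq_one_iff.mp h))
  omega

theorem minFac_absNorm_of_prime {P : Ideal (𝓞 K)} (hP : Prime P) :
    (Ideal.absNorm P).minFac.Prime ∧ ((Ideal.absNorm P).minFac : 𝓞 K) ∈ P ∧
      (Ideal.absNorm P).minFac ≤ Ideal.absNorm P ∧
      (Ideal.absNorm P = (Ideal.absNorm P).minFac ∨
        (Ideal.absNorm P).minFac ^ 2 ≤ Ideal.absNorm P) := by
  have : P.IsMaximal := (Ideal.isPrime_of_prime hP).isMaximal hP.ne_zero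
  obtain ⟨p, n, hn, hpP, hp, h⟩ := Ideal.exists_prime_and_absNorm_eq_pow P
  have hmin : (Ideal.absNorm P).minFac = p := by rw [h, hp.pow_minFac hn.ne']
  rw [hmin]
  refine ⟨hp, hpP, ?_, ?_⟩
  · rw [h]
    exact Nat.le_self_pow hn.ne' p
  · rw [h]
    rcases (show n = 1 ∨ 2 ≤ n by omega) with rfl | hn
    · exact Or.inl (pow_one p)
    · exact Or.inr (Nat.pow_le_pow_right hp.pos hn)

theorem card_le_finrank_of_minFac_absNorm_eq {p : ℕ} {Q : Finset (Ideal (𝓞 K))}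
    (hQ : ∀ P ∈ Q, Prime P ∧ (Ideal.absNorm P).minFac = p) :
    Q.card ≤ Module.finrank ℤ (𝓞 K) := by
  rcases Q.eq_empty_or_nonempty with rfl | ⟨P₀, hP₀⟩
  · simp
  have hp : p.Prime := (hQ P₀ hP₀).2 ▸ (minFac_absNorm_of_prime (hQ P₀ hP₀).1).1
  have h1 : ∏ P ∈ Q, P ∣ Ideal.span {(p : 𝓞 K)} := by
    refine Finset.prod_primes_dvd _ (fun P hP => (hQ P hP).1) fun P hP => ?_
    rw [Ideal.dvd_span_singleton, ← (hQ P hP).2]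
    exact (minFac_absNorm_of_prime (hQ P hP).1).2.1
  have h2 := map_dvd Ideal.absNorm h1
  rw [map_prod, Ideal.absNorm_span_natCast] at h2
  have h3 : p ^ Q.card ≤ ∏ P ∈ Q, Ideal.absNorm P := by
    refine Finset.pow_card_le_prod Q _ _ fun P hP => ?_
    have := (minFac_absNorm_of_prime (hQ P hP).1).2.2.1
    rwa [(hQ P hP).2] at this
  exact (Nat.pow_le_pow_iff_right hp.one_lt).mp
    (h3.trans (Nat.le_of_dvd (pow_pos hp.pos _) h2))

variable (K) in
/-- The rational primes that are norms of ideals of `𝓞 K`. -/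
def normPrimes : Set ℕ := {p | p.Prime ∧ ∃ P : Ideal (𝓞 K), Ideal.absNorm P = p}

theorem one_div_absNorm_le {P : Ideal (𝓞 K)} (hP : Prime P) :
    1 / (Ideal.absNorm P : ℝ) ≤ (normPrimes K).indicator (fun p : ℕ => 1 / (p : ℝ))
      (Ideal.absNorm P).minFac + 1 / ((Ideal.absNorm P).minFac : ℝ) ^ 2 := by
  obtain ⟨hp, -, -, h⟩ := minFac_absNorm_of_prime hP
  have hpos : (0 : ℝ) < (Ideal.absNorm P).minFac := by exact_mod_cast hp.pos
  rcases h with h | h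
  · rw [Set.indicator_of_mem (show _ ∈ normPrimes K from ⟨hp, P, h⟩), ← h]
    have : (0 : ℝ) ≤ 1 / (Ideal.absNorm P : ℝ) ^ 2 := by positivity
    linarith
  · have h1 : 1 / (Ideal.absNorm P : ℝ) ≤ 1 / ((Ideal.absNorm P).minFac : ℝ) ^ 2 := by
      apply one_div_le_one_div_of_le (by positivity)
      exact_mod_cast h
    have h2 : 0 ≤ (normPrimes K).indicator (fun p : ℕ => 1 / (p : ℝ))
      (Ideal.absNorm P).minFac := Set.indicator_nonneg (fun _ _ => by positivity) _
    linarith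

theorem sum_one_div_absNorm_le {Q : Finset (Ideal (𝓞 K))} (hQ : ∀ P ∈ Q, Prime P) :
    ∑ P ∈ Q, 1 / (Ideal.absNorm P : ℝ) ≤ Module.finrank ℤ (𝓞 K) *
      ∑ p ∈ Q.image (fun P => (Ideal.absNorm P).minFac),
        ((normPrimes K).indicator (fun p : ℕ => 1 / (p : ℝ)) p + 1 / (p : ℝ) ^ 2) := by
  rw [← Finset.sum_fiberwise_of_maps_to (g := fun P => (Ideal.absNorm P).minFac)
    (fun P hP => Finset.mem_image_of_mem (fun P => (Ideal.absNorm P).minFac) hP), Finset.mul_sum]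
  refine Finset.sum_le_sum fun p _ => ?_
  have hnn : 0 ≤ (normPrimes K).indicator (fun p : ℕ => 1 / (p : ℝ)) p + 1 / (p : ℝ) ^ 2 :=
    add_nonneg (Set.indicator_nonneg (fun _ _ => by positivity) _) (by positivity)
  calc _ ≤ ∑ P ∈ Q with (Ideal.absNorm P).minFac = p,
        ((normPrimes K).indicator (fun p : ℕ => 1 / (p : ℝ)) p + 1 / (p : ℝ) ^ 2) := by
        refine Finset.sum_le_sum fun P hP => ?_
        rw [Finset.mem_filter] at hP
        rw [← hP.2]
        exact one_div_absNorm_le (hQ P hP.1)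
    _ ≤ _ := by
        rw [Finset.sum_const, nsmul_eq_mul]
        refine mul_le_mul_of_nonneg_right ?_ hnn
        exact_mod_cast card_le_finrank_of_minFac_absNorm_eq fun P hP =>
          ⟨hQ P (Finset.mem_filter.mp hP).1, (Finset.mem_filter.mp hP).2⟩

open UniqueFactorizationMonoid in
theorem card_filter_forall_prime_dvd_mem_le (Q : Finset (Ideal (𝓞 K))) (n : ℕ) :
    open Classical in
    ((idealsLE K n).filter fun I => ∀ P, Prime P → P ∣ I → P ∈ Q).card
      ≤ (Nat.log 2 n + 1) ^ Q.card := by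
  classical
  have hcard : (Fintype.piFinset fun _ : Q => Finset.range (Nat.log 2 n + 1)).card
      = (Nat.log 2 n + 1) ^ Q.card := by
    simp
  rw [← hcard]
  refine Finset.card_le_card_of_injOn
    (fun I (P : Q) => (normalizedFactors I).count (P : Ideal (𝓞 K))) ?_ ?_
  · intro I hI
    rw [Finset.mem_coe, Finset.mem_filter, mem_idealsLE] at hI
    rw [Finset.mem_coe, Fintype.mem_piFinset]
    intro P
    rw [Finset.mem_range, Nat.lt_succ_iff]
    rcases Nat.eq_zero_or_pos ((normalizedFactors I).count (P : Ideal (𝓞 K))) with h0 | h0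
    · exact h0.trans_le (Nat.zero_le _)
    have hP := prime_of_normalized_factor _ (Multiset.count_pos.mp h0)
    have hdvd : (P : Ideal (𝓞 K)) ^ ((normalizedFactors I).count (P : Ideal (𝓞 K))) ∣ I := by
      rw [← Multiset.prod_replicate]
      exact (Multiset.prod_dvd_prod_of_le (Multiset.le_count_iff_replicate_le.mp le_rfl)).trans
        (prod_normalizedFactors hI.1.2).dvd
    refine Nat.le_log_of_pow_le (by norm_num) ?_
    calc _ ≤ Ideal.absNorm (P : Ideal (𝓞 K)) ^ _ :=
          Nat.pow_le_pow_left (two_le_absNorm_of_prime hP) _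
      _ ≤ Ideal.absNorm I := by
          rw [← map_pow]
          exact Nat.le_of_dvd (absNorm_pos_of_ne_zero hI.1.2) (map_dvd _ hdvd)
      _ ≤ n := hI.1.1
  · intro I hI J hJ h
    rw [Finset.mem_coe, Finset.mem_filter, mem_idealsLE] at hI hJ
    have hmem : ∀ {I : Ideal (𝓞 K)}, (∀ P, Prime P → P ∣ I → P ∈ Q) → ∀ P ∉ Q,
        (normalizedFactors I).count P = 0 := fun hI P hPQ =>
      Multiset.count_eq_zero.mpr fun hP => hPQ (hI P (prime_of_normalized_factor P hP)
        (dvd_of_mem_normalizedFactors hP))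
    have heq : normalizedFactors I = normalizedFactors J := by
      ext P
      by_cases hP : P ∈ Q
      · exact congrFun h ⟨P, hP⟩
      · rw [hmem hI.2 P hP, hmem hJ.2 P hP]
    exact associated_iff_eq.mp ((prod_normalizedFactors hI.1.2).symm.trans
      (heq ▸ prod_normalizedFactors hJ.1.2))

variable (K) in
theorem exists_card_idealsLE_le_mul :
    ∃ C : ℝ, 0 < C ∧ ∀ n : ℕ, ((idealsLE K n).card : ℝ) ≤ C * n := by
  have hκ := dedekindZeta_residue_pos K
  obtain ⟨s₀, hs₀⟩ := eventually_atTop.mp (eventually_card_idealsLE_bounds (K := K) one_pos)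
  obtain ⟨t₀, ht₀⟩ := exists_nat_ge s₀
  have hmono : ∀ {m n : ℕ}, m ≤ n → idealsLE K m ⊆ idealsLE K n := fun h I hI =>
    mem_idealsLE.mpr ⟨(mem_idealsLE.mp hI).1.trans h, (mem_idealsLE.mp hI).2⟩
  refine ⟨(1 + 1) * dedekindZeta_residue K + (idealsLE K t₀).card, by positivity, fun n => ?_⟩
  have hc : (0 : ℝ) ≤ (idealsLE K t₀).card := Nat.cast_nonneg _
  have hn : (0 : ℝ) ≤ n := Nat.cast_nonneg _
  rcases le_total t₀ n with h | h
  · have h1 := (hs₀ n (ht₀.trans (by exact_mod_cast h))).2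
    rw [Nat.floor_natCast] at h1
    nlinarith
  · rcases Nat.eq_zero_or_pos n with rfl | h0
    · have : idealsLE K 0 = ∅ := by
        refine Finset.eq_empty_of_forall_notMem fun I hI => ?_
        rw [mem_idealsLE] at hI
        exact absurd (absNorm_pos_of_ne_zero hI.2) (by omega)
      simp [this]
    · have h1 : ((idealsLE K n).card : ℝ) ≤ (idealsLE K t₀).card := by
        exact_mod_cast Finset.card_le_card (hmono h)
      have h2 : (1 : ℝ) ≤ n := by exact_mod_cast h0
      nlinarith

theorem eventually_natLog_add_one_pow_le (m : ℕ) {ε : ℝ} (hε : 0 < ε) :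
    ∀ᶠ n : ℕ in atTop, ((Nat.log 2 n : ℝ) + 1) ^ m ≤ ε * n := by
  have h1 := (Real.isLittleO_pow_log_id_atTop (n := m)).def
    (show (0 : ℝ) < ε / 4 ^ m by positivity)
  filter_upwards [tendsto_natCast_atTop_atTop.eventually h1,
    (Real.tendsto_log_atTop.comp tendsto_natCast_atTop_atTop).eventually (eventually_ge_atTop 1),
    eventually_ge_atTop 1] with n hn hl hn1
  simp only [Function.comp_apply, id_eq, Real.norm_eq_abs, Nat.abs_cast] at hn hl
  rw [abs_of_nonneg (by positivity)] at hn
  have h2 : (Nat.log 2 n : ℝ) ≤ 2 * Real.log n := by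
    have h3 : ((2 : ℕ) : ℝ) ^ Nat.log 2 n ≤ n := by
      exact_mod_cast Nat.pow_log_le_self 2 (by omega)
    have h4 := Real.log_le_log (by positivity) h3
    rw [Real.log_pow] at h4
    have := Real.log_two_gt_d9
    push_cast at h4
    nlinarith [Nat.cast_nonneg (α := ℝ) (Nat.log 2 n)]
  calc _ ≤ (4 * Real.log n) ^ m := by
        gcongr
        linarith
    _ = 4 ^ m * Real.log n ^ m := mul_pow _ _ _
    _ ≤ 4 ^ m * (ε / 4 ^ m * n) := by gcongr
    _ = _ := by field_simp

variable (K) in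
theorem not_summable_indicator_normPrimes :
    ¬ Summable ((normPrimes K).indicator fun p : ℕ => 1 / (p : ℝ)) := by
  classical
  intro hsum
  have hκ := dedekindZeta_residue_pos K
  obtain ⟨C, hC, hbound⟩ := exists_card_idealsLE_le_mul K
  set κ := dedekindZeta_residue K
  set d := Module.finrank ℤ (𝓞 K) with hd
  set g : ℕ → ℝ := fun p => (normPrimes K).indicator (fun p : ℕ => 1 / (p : ℝ)) p + 1 / (p : ℝ) ^ 2
    with hg
  have hgs : Summable g := hsum.add (Real.summable_one_div_nat_pow.mpr one_lt_two)
  have hδ : 0 < κ / (4 * C * (d + 1)) := by positivity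
  obtain ⟨s, hs⟩ := summable_iff_vanishing_norm.mp hgs _ hδ
  obtain ⟨Y, hY⟩ := s.bddAbove
  have hlow := tendsto_natCast_atTop_atTop.eventually
    (eventually_card_idealsLE_bounds (K := K) (show (0 : ℝ) < 1 / 2 by norm_num))
  obtain ⟨n, hn1, hn2, hn0⟩ := ((eventually_natLog_add_one_pow_le (d * (Y + 1))
    (show 0 < κ / 8 by positivity)).and (hlow.and (eventually_gt_atTop 0))).exists
  have hn2 := hn2.1
  rw [Nat.floor_natCast] at hn2
  have hn0' : (0 : ℝ) < n := by exact_mod_cast hn0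
  set Q₁ := (idealsLE K n).filter fun P => Prime P ∧ (Ideal.absNorm P).minFac ≤ Y with hQ₁
  set Q₂ := (idealsLE K n).filter fun P => Prime P ∧ Y < (Ideal.absNorm P).minFac with hQ₂
  have hQ₁card : Q₁.card ≤ d * (Y + 1) := by
    have h1 := Finset.card_le_mul_card_image_of_maps_to (s := Q₁) (t := Finset.range (Y + 1))
      (f := fun P => (Ideal.absNorm P).minFac) (fun P hP => by
        rw [Finset.mem_range, Nat.lt_succ_iff]
        exact (Finset.mem_filter.mp hP).2.2) d (fun p _ =>
        card_le_finrank_of_minFac_absNorm_eq fun P hP => by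
          rw [Finset.mem_filter, hQ₁, Finset.mem_filter] at hP
          exact ⟨hP.1.2.1, hP.2⟩)
    simpa using h1
  have hcover : idealsLE K n ⊆ ((idealsLE K n).filter fun I => ∀ P, Prime P → P ∣ I → P ∈ Q₁) ∪
      Q₂.biUnion fun P => (idealsLE K n).filter (P ∣ ·) := by
    intro I hI
    rw [Finset.mem_union]
    by_contra! hcon
    refine hcon.1 (Finset.mem_filter.mpr ⟨hI, fun P hP hPI => ?_⟩)
    rw [mem_idealsLE] at hI
    have hPn : P ∈ idealsLE K n := mem_idealsLE.mpr
      ⟨(Nat.le_of_dvd (absNorm_pos_of_ne_zero hI.2) (map_dvd _ hPI)).trans hI.1, hP.ne_zero⟩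
    refine Finset.mem_filter.mpr ⟨hPn, hP, not_lt.mp fun hlt => hcon.2 ?_⟩
    exact Finset.mem_biUnion.mpr ⟨P, Finset.mem_filter.mpr ⟨hPn, hP, hlt⟩,
      Finset.mem_filter.mpr ⟨mem_idealsLE.mpr hI, hPI⟩⟩
  have hcount : ((idealsLE K n).card : ℝ) ≤ ((Nat.log 2 n : ℝ) + 1) ^ (d * (Y + 1)) +
      ∑ P ∈ Q₂, C * (n / Ideal.absNorm P) := by
    calc ((idealsLE K n).card : ℝ)
        ≤ (((idealsLE K n).filter fun I => ∀ P, Prime P → P ∣ I → P ∈ Q₁).card : ℝ) +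
          ∑ P ∈ Q₂, (((idealsLE K n).filter (P ∣ ·)).card : ℝ) := by
          have := (Finset.card_le_card hcover).trans ((Finset.card_union_le _ _).trans
            (Nat.add_le_add_left Finset.card_biUnion_le _))
          exact_mod_cast this
      _ ≤ _ := by
          refine add_le_add ?_ (Finset.sum_le_sum fun P hP => ?_)
          · have h1 := card_filter_forall_prime_dvd_mem_le Q₁ n
            have h2 : (Nat.log 2 n + 1) ^ Q₁.card ≤ (Nat.log 2 n + 1) ^ (d * (Y + 1)) :=
              Nat.pow_le_pow_right (by omega) hQ₁card
            exact_mod_cast h1.trans h2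
          · rw [card_filter_dvd_idealsLE (Finset.mem_filter.mp hP).2.1.ne_zero]
            refine (hbound _).trans ?_
            gcongr
            exact Nat.cast_div_le
  have htail : ∑ P ∈ Q₂, C * (n / Ideal.absNorm P) ≤ κ / 4 * n := by
    have h1 := sum_one_div_absNorm_le
      (fun P hP => (Finset.mem_filter.mp hP).2.1 : ∀ P ∈ Q₂, Prime P)
    have h2 := hs (Q₂.image fun P => (Ideal.absNorm P).minFac) (by
      rw [Finset.disjoint_left]
      intro p hp hps
      obtain ⟨P, hP, rfl⟩ := Finset.mem_image.mp hp
      exact absurd (hY hps) (not_le.mpr (Finset.mem_filter.mp hP).2.2))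
    have h3 := (le_abs_self _).trans h2.le
    calc ∑ P ∈ Q₂, C * (n / Ideal.absNorm P) = C * n * ∑ P ∈ Q₂, 1 / (Ideal.absNorm P : ℝ) := by
          rw [Finset.mul_sum]
          exact Finset.sum_congr rfl fun P _ => by ring
      _ ≤ C * n * (d * (κ / (4 * C * (d + 1)))) := by
          gcongr
          exact h1.trans (by gcongr)
      _ = κ / 4 * n * (d / (d + 1)) := by field_simp
      _ ≤ κ / 4 * n * 1 := by
          gcongr
          rw [div_le_one (by positivity)]
          linarith
      _ = _ := by ring
  nlinarith [mul_pos hκ hn0']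

end

theorem exists_finset_prod_one_sub_le {D : Set ℕ} (hD : ∀ p ∈ D, p.Prime)
    (hsum : ¬ Summable (D.indicator fun p : ℕ => 1 / (p : ℝ))) {ε : ℝ} (hε : 0 < ε) :
    ∃ S : Finset ℕ, (∀ p ∈ S, p ∈ D) ∧ ∏ p ∈ S, (1 - 1 / (p : ℝ)) ≤ ε := by
  classical
  have hnn : ∀ n, 0 ≤ D.indicator (fun p : ℕ => 1 / (p : ℝ)) n :=
    fun n => Set.indicator_nonneg (fun _ _ => by positivity) n
  obtain ⟨n, hn⟩ := (((not_summable_iff_tendsto_nat_atTop_of_nonneg hnn).mp hsum).eventually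
    (Filter.eventually_ge_atTop (-Real.log ε))).exists
  refine ⟨(Finset.range n).filter (· ∈ D), fun p hp => (Finset.mem_filter.mp hp).2, ?_⟩
  calc ∏ p ∈ (Finset.range n).filter (· ∈ D), (1 - 1 / (p : ℝ))
      ≤ ∏ p ∈ (Finset.range n).filter (· ∈ D), Real.exp (-(1 / (p : ℝ))) := by
        refine Finset.prod_le_prod (fun p hp =>
          one_sub_one_div_prime_nonneg (hD p (Finset.mem_filter.mp hp).2)) fun p _ => ?_
        linarith [Real.add_one_le_exp (-(1 / (p : ℝ)))]
    _ = Real.exp (-∑ p ∈ Finset.range n, D.indicator (fun p : ℕ => 1 / (p : ℝ)) p) := by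
        rw [← Real.exp_sum, Finset.sum_neg_distrib, Finset.sum_filter]
        simp only [Set.indicator_apply]
    _ ≤ Real.exp (Real.log ε) := Real.exp_le_exp.mpr (by linarith)
    _ = ε := Real.exp_log hε

theorem not_summable_indicator_of_finite_diff {D E : Set ℕ}
    (hsum : ¬ Summable (E.indicator fun p : ℕ => 1 / (p : ℝ))) (hfin : (E \ D).Finite) :
    ¬ Summable (D.indicator fun p : ℕ => 1 / (p : ℝ)) := by
  intro h
  have h1 : Summable ((E \ D).indicator fun p : ℕ => 1 / (p : ℝ)) :=
    summable_of_hasFiniteSupport (hfin.subset Set.support_indicator_subset)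
  refine hsum ((h.add h1).of_nonneg_of_le
    (fun n => Set.indicator_nonneg (fun _ _ => by positivity) n) fun n => ?_)
  by_cases hE : n ∈ E <;> by_cases hD : n ∈ D <;> simp [hE, hD]

theorem exists_forall_infinite_of_prime_pairs {f : ℤ[X]} (hf : f ≠ 0) {D : Set ℕ}
    (hD : ∀ p ∈ D, p.Prime ∧ ∃ x : ℤ, (p : ℤ) ∣ f.eval x)
    (hsum : ¬ Summable (D.indicator fun p : ℕ => 1 / (p : ℝ))) {P : ℤ[X]} {W : ℕ} (hW : 0 < W)
    (hP : ∃ c : ℝ, 0 < c ∧ ∀ᶠ X : ℕ in Filter.atTop, c * X ≤ (largePrimeFactors P X).card)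
    (hpair : ∀ t p : ℕ, 1 ≤ t → p.Prime → (p : ℤ) ∣ P.eval (t : ℤ) →
      ∃ x : ℤ, (p : ℤ) ∣ f.eval x ∧ (p : ℤ) ∣ f.eval (x + (W * t : ℕ))) :
    ∃ G : ℕ, 2 ≤ G ∧ ∀ k : ℕ, G ≤ k →
      {n : ℕ | ∀ i ∈ Finset.Icc 1 k, ∃ j ∈ Finset.Icc 1 k, j ≠ i ∧
        1 < Int.gcd (f.eval ((n + i : ℕ) : ℤ)) (f.eval ((n + j : ℕ) : ℤ))}.Infinite := by
  obtain ⟨c, hc, hev⟩ := hP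
  obtain ⟨X₀, hX₀⟩ := Filter.eventually_atTop.mp hev
  have hW' : (0 : ℝ) < W := by exact_mod_cast hW
  obtain ⟨S, hSD, hS⟩ := exists_finset_prod_one_sub_le (fun p hp => (hD p hp).1) hsum
    (show 0 < c / (5 * W) by positivity)
  obtain ⟨C, hC⟩ := S.bddAbove
  refine ⟨2 * (W * (X₀ + C + 2)) + 2, by omega, fun k hk => ?_⟩
  set X := k / 2 / W with hX
  have hX1 : X₀ + C + 2 ≤ X := by
    rw [hX, Nat.le_div_iff_mul_le hW, Nat.le_div_iff_mul_le two_pos]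
    linarith
  have hX2 : 2 * (X * W) ≤ k := by
    have h1 : X * W ≤ k / 2 := Nat.div_mul_le_self (k / 2) W
    omega
  have hX3 : k ≤ 5 * (W * X) := by
    have h1 := Nat.lt_div_mul_add hW (a := k / 2)
    rw [← hX] at h1
    have h2 : W ≤ X * W := Nat.le_mul_of_pos_left W (by omega)
    have h3 : X * W = W * X := mul_comm _ _
    omega
  have hCX : C ≤ X * W := (by omega : C ≤ X).trans (Nat.le_mul_of_pos_right X hW)
  have hT : ∀ p ∈ largePrimeFactors P X, p.Prime ∧ X < p ∧ ∃ t ∈ Finset.Icc 1 X,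
      (p : ℤ) ∣ P.eval (t : ℤ) := by
    intro p hp
    simp only [largePrimeFactors, Finset.mem_biUnion, Finset.mem_filter,
      Nat.mem_primeFactors] at hp
    obtain ⟨t, ht, ⟨hpp, hdvd, -⟩, hlt⟩ := hp
    exact ⟨hpp, hlt, t, ht, Int.natCast_dvd.mpr hdvd⟩
  refine infinite_of_sieve hf ∅ S (largePrimeFactors P X) (Finset.disjoint_empty_left _)
    (Finset.disjoint_empty_left _) ?_ (by simp) 0 (fun p hp => ?_) (fun p hp => ?_)
    (Finset.Icc 1 k) subset_rfl (fun i hi hi' => absurd hi hi') ?_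
  · rw [Finset.disjoint_left]
    intro p hp hp'
    have h1 : p ≤ C := hC hp
    have h2 := (hT p hp').2.1
    omega
  · have h1 : p ≤ C := hC hp
    exact ⟨(hD p (hSD p hp)).1, by omega, (hD p (hSD p hp)).2⟩
  · obtain ⟨hpp, -, t, ht, hdvd⟩ := hT p hp
    rw [Finset.mem_Icc] at ht
    refine ⟨hpp, fun i hi => ?_⟩
    obtain ⟨x, h0, h1⟩ := hpair t p ht.1 hpp hdvd
    refine mem_coveredBy_of_dvd_of_dvd (Nat.mul_pos hW ht.1) ?_ h0 h1 hi
    have : W * t ≤ X * W := (Nat.mul_le_mul_left W ht.2).trans_eq (mul_comm _ _)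
    omega
  · have h1 : (k : ℝ) ≤ 5 * (W * X) := by exact_mod_cast hX3
    rw [Nat.card_Icc, Nat.add_sub_cancel]
    calc (k : ℝ) * ∏ p ∈ S, (1 - 1 / (p : ℝ)) ≤ k * (c / (5 * W)) := by gcongr
      _ ≤ 5 * (W * X) * (c / (5 * W)) := by gcongr
      _ = c * X := by field_simp
      _ ≤ _ := hX₀ X (by omega)

section

variable {K : Type*} [Field K] [NumberField K]

theorem exists_dvd_eval_minpoly_of_mem_normPrimes (β : 𝓞 K) {p : ℕ} (hp : p ∈ normPrimes K) :
    ∃ x : ℤ, (p : ℤ) ∣ (minpoly ℤ β).eval x := by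
  obtain ⟨hp, P, hP⟩ := hp
  have : Fact p.Prime := ⟨hp⟩
  have hcard : Nat.card (𝓞 K ⧸ P) = p := hP
  have hfin : Finite (𝓞 K ⧸ P) := Nat.finite_of_card_ne_zero (hcard ▸ hp.ne_zero)
  have := Fintype.ofFinite (𝓞 K ⧸ P)
  let e := ZMod.ringEquivOfPrime (𝓞 K ⧸ P) hp (by rw [← Nat.card_eq_fintype_card, hcard])
  let φ : 𝓞 K →+* ZMod p := (e.symm : 𝓞 K ⧸ P →+* ZMod p).comp (Ideal.Quotient.mk P)
  obtain ⟨x, hx⟩ := ZMod.intCast_surjective (φ β)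
  refine ⟨x, (ZMod.intCast_zmod_eq_zero_iff_dvd _ _).mp ?_⟩
  have h := congrArg φ (minpoly.aeval ℤ β)
  rw [map_zero, aeval_def, hom_eval₂, ← hx] at h
  rw [← h, ← eq_intCast (Int.castRingHom (ZMod p)), ← eval₂_hom]
  congr 1
  exact RingHom.ext_int _ _

theorem exponent_ne_zero_of_powerBasis (B : PowerBasis ℚ K) {β : 𝓞 K} (hB : B.gen = β) :
    RingOfIntegers.exponent β ≠ 0 := by
  have h_int : IsIntegral ℤ B.gen := hB ▸ RingOfIntegers.isIntegral_coe β
  obtain ⟨d, hd⟩ := IsIntegrallyClosed.isIntegral_iff.mp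
    (Algebra.discr_isIntegral ℚ (R := ℤ) (b := B.basis) fun i => by
      rw [B.basis_eq_pow]; exact h_int.pow _)
  have hd0 : d ≠ 0 := by
    rintro rfl
    rw [map_zero] at hd
    exact Algebra.discr_not_zero_of_basis ℚ B.basis hd.symm
  have hmem : (d : 𝓞 K) ∈ conductor ℤ β := by
    rw [mem_conductor_iff]
    intro b
    have h := Algebra.discr_mul_isIntegral_mem_adjoin ℚ h_int (RingOfIntegers.isIntegral_coe b)
    rw [← hd, hB] at h
    have h1 : algebraMap (𝓞 K) K ((d : 𝓞 K) * b) ∈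
        (Algebra.adjoin ℤ {β}).map (IsScalarTower.toAlgHom ℤ (𝓞 K) K) := by
      rw [AlgHom.map_adjoin, Set.image_singleton]
      convert h using 1
      · rfl
      · rw [Algebra.smul_def, map_mul]
        simp
    obtain ⟨z, hz, hzb⟩ := h1
    have : z = (d : 𝓞 K) * b := RingOfIntegers.coe_injective hzb
    exact this ▸ hz
  have hne : {d : ℕ | 0 < d ∧ (d : 𝓞 K) ∈ conductor ℤ β}.Nonempty := by
    refine ⟨d.natAbs, Int.natAbs_pos.mpr hd0, ?_⟩
    rcases Int.natAbs_eq d with h | h <;> rw [h] at hmem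
    · simpa using hmem
    · simpa using hmem
  rw [RingOfIntegers.exponent_eq_sInf]
  exact (Nat.sInf_mem hne).1.ne'

theorem exists_absNorm_eq_and_sub_mem {β : 𝓞 K} {p : ℕ} (hp : p.Prime)
    (hpβ : ¬ p ∣ RingOfIntegers.exponent β) {x : ℤ} (hx : (p : ℤ) ∣ (minpoly ℤ β).eval x) :
    ∃ P : Ideal (𝓞 K), Ideal.absNorm P = p ∧ β - (x : 𝓞 K) ∈ P := by
  have : Fact p.Prime := ⟨hp⟩
  have hx' : ((minpoly ℤ β).map (Int.castRingHom (ZMod p))).eval (x : ZMod p) = 0 := by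
    rw [eval_intCast_map, eq_intCast, ZMod.intCast_zmod_eq_zero_iff_dvd]
    exact hx
  let e := RingOfIntegers.ZModXQuotSpanEquivQuotSpan hpβ
  let ψ : (ZMod p)[X] ⧸ Ideal.span {(minpoly ℤ β).map (Int.castRingHom (ZMod p))} →+* ZMod p :=
    Ideal.Quotient.lift _ (evalRingHom (x : ZMod p)) (fun q hq => by
      rw [Ideal.mem_span_singleton] at hq
      obtain ⟨r, rfl⟩ := hq
      simp [hx'])
  let φ : 𝓞 K →+* ZMod p := (ψ.comp e.symm.toRingHom).comp (Ideal.Quotient.mk _)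
  have hφ : φ β = x := by
    have h1 : e.symm (Ideal.Quotient.mk _ β) =
        Ideal.Quotient.mk _ ((X : ℤ[X]).map (Int.castRingHom (ZMod p))) := by
      rw [RingEquiv.symm_apply_eq, RingOfIntegers.ZModXQuotSpanEquivQuotSpan_mk_apply, aeval_X]
    change ψ (e.symm (Ideal.Quotient.mk _ β)) = x
    rw [h1]
    simp [ψ]
  refine ⟨RingHom.ker φ, ?_, ?_⟩
  · have h2 : Function.Surjective φ := ZMod.ringHom_surjective φ
    rw [Ideal.absNorm_apply, Submodule.cardQuot_apply]
    exact (Nat.card_congr (RingHom.quotientKerEquivOfSurjective h2).toEquiv).trans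
      (Nat.card_zmod p)
  · rw [RingHom.mem_ker, map_sub, hφ, map_intCast, sub_self]

theorem exists_ideal_ne_of_dvd_eval_minpoly {β : 𝓞 K} {p : ℕ} (hp : p.Prime)
    (hpβ : ¬ p ∣ RingOfIntegers.exponent β) {x y : ℤ} (hx : (p : ℤ) ∣ (minpoly ℤ β).eval x)
    (hy : (p : ℤ) ∣ (minpoly ℤ β).eval y) (hxy : ¬ (p : ℤ) ∣ x - y) :
    ∃ P Q : Ideal (𝓞 K), P ≠ Q ∧ Ideal.absNorm P = p ∧ Ideal.absNorm Q = p := by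
  obtain ⟨P, hP, hPx⟩ := exists_absNorm_eq_and_sub_mem hp hpβ hx
  obtain ⟨Q, hQ, hQy⟩ := exists_absNorm_eq_and_sub_mem hp hpβ hy
  refine ⟨P, Q, ?_, hP, hQ⟩
  rintro rfl
  have h1 : ((x - y : ℤ) : 𝓞 K) ∈ P := by
    have := P.sub_mem hQy hPx
    rw [sub_sub_sub_cancel_left] at this
    exact_mod_cast this
  have h2 : (p : 𝓞 K) ∈ P := hP ▸ Ideal.absNorm_mem P
  obtain ⟨u, v, huv⟩ := (Nat.prime_iff_prime_int.mp hp).coprime_iff_not_dvd.mpr hxy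
  have h3 : (1 : 𝓞 K) ∈ P := by
    have h4 : (1 : 𝓞 K) = (u : 𝓞 K) * (p : 𝓞 K) + (v : 𝓞 K) * ((x - y : ℤ) : 𝓞 K) := by
      exact_mod_cast congrArg (Int.cast : ℤ → 𝓞 K) huv.symm
    rw [h4]
    exact P.add_mem (P.mul_mem_left _ h2) (P.mul_mem_left _ h1)
  rw [← Ideal.eq_top_iff_one] at h3
  rw [h3, Ideal.absNorm_top] at hP
  exact hp.one_lt.ne hP

end

theorem exists_numberField_of_irreducible_map {F : ℤ[X]} (hF : F.Monic)
    (hirr : Irreducible (F.map (Int.castRingHom ℚ))) :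
    ∃ (K : Type) (_ : Field K) (_ : NumberField K) (β : 𝓞 K),
      minpoly ℤ β = F ∧ RingOfIntegers.exponent β ≠ 0 := by
  have := Fact.mk hirr
  have hFQ : (F.map (Int.castRingHom ℚ)).Monic := hF.map _
  let θ := AdjoinRoot.root (F.map (Int.castRingHom ℚ))
  have hmin : minpoly ℚ θ = F.map (Int.castRingHom ℚ) :=
    AdjoinRoot.minpoly_root hFQ.ne_zero |>.trans (by simp [hFQ.leadingCoeff])
  have h_int : IsIntegral ℤ θ := by
    refine ⟨F, hF, ?_⟩
    have h := minpoly.aeval ℚ θ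
    rw [hmin] at h
    rw [← h, aeval_def, eval₂_map]
    congr 1
  refine ⟨AdjoinRoot (F.map (Int.castRingHom ℚ)), inferInstance, inferInstance, ⟨θ, h_int⟩, ?_, ?_⟩
  · apply Polynomial.map_injective (Int.castRingHom ℚ) Int.cast_injective
    refine Eq.trans (Eq.symm ?_) hmin
    exact minpoly.isIntegrallyClosed_eq_field_fractions ℚ
      (AdjoinRoot (F.map (Int.castRingHom ℚ))) (RingOfIntegers.isIntegral ⟨θ, h_int⟩)
  · exact exponent_ne_zero_of_powerBasis (AdjoinRoot.powerBasis hirr.ne_zero) rfl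

theorem exists_forall_infinite_of_irreducible {f F : ℤ[X]} (hf : f ≠ 0) (hF : F.Monic)
    (hirr : Irreducible (F.map (Int.castRingHom ℚ))) {a : ℤ} (ha : a ≠ 0) {e : ℕ}
    (hFf : ∀ x : ℤ, F.eval (a * x) = a ^ e * f.eval x)
    (hP : ∀ N : ℕ, 0 < N → ∃ (P : ℤ[X]) (W : ℕ), 0 < W ∧ 0 < P.natDegree ∧
      (∀ t : ℕ, 1 ≤ t → t ^ P.natDegree ≤ (P.eval (t : ℤ)).natAbs) ∧
      ∀ (t : ℤ) (p : ℕ), p.Prime → (p : ℤ) ∣ P.eval t → ¬ p ∣ N ∧ ¬ (p : ℤ) ∣ W * t ∧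
        ¬ (p : ℤ) ∣ P.derivative.eval t ∧ ¬ (p : ℤ) ∣ P.eval 0 ∧
        ∃ x : ℤ, (p : ℤ) ∣ f.eval x ∧ (p : ℤ) ∣ f.eval (x + W * t)) :
    ∃ G : ℕ, 2 ≤ G ∧ ∀ k : ℕ, G ≤ k →
      {n : ℕ | ∀ i ∈ Finset.Icc 1 k, ∃ j ∈ Finset.Icc 1 k, j ≠ i ∧
        1 < Int.gcd (f.eval ((n + i : ℕ) : ℤ)) (f.eval ((n + j : ℕ) : ℤ))}.Infinite := by
  obtain ⟨K, _, _, β, hβ, hexp⟩ := exists_numberField_of_irreducible_map hF hirr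
  have hFdvd : ∀ {p : ℕ} {x : ℤ}, (p : ℤ) ∣ f.eval x → (p : ℤ) ∣ F.eval (a * x) := by
    intro p x h
    rw [hFf]
    exact h.mul_left _
  obtain ⟨P, W, hW, hdeg, hlow, hprime⟩ := hP (Nat.factorial 20 * a.natAbs *
    RingOfIntegers.exponent β) (Nat.mul_pos (Nat.mul_pos (Nat.factorial_pos _)
      (Int.natAbs_pos.mpr ha)) (Nat.pos_of_ne_zero hexp))
  let S : Set ℕ := {p | p.Prime ∧ 20 ≤ p ∧
    ∃ P Q : Ideal (𝓞 K), P ≠ Q ∧ Ideal.absNorm P = p ∧ Ideal.absNorm Q = p}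
  have hS : ∀ (t : ℤ) (p : ℕ), p.Prime → (p : ℤ) ∣ P.eval t → p ∈ S := by
    intro t p hp hpt
    obtain ⟨hN, hWt, -, -, x, hx, hy⟩ := hprime t p hp hpt
    rw [hp.dvd_mul, hp.dvd_mul, hp.dvd_factorial] at hN
    push Not at hN
    have hpa : ¬ (p : ℤ) ∣ a := fun h => hN.1.2 (Int.natCast_dvd.mp h)
    refine ⟨hp, hN.1.1.le, exists_ideal_ne_of_dvd_eval_minpoly hp hN.2 (hβ ▸ hFdvd hy)
      (hβ ▸ hFdvd hx) fun h => ?_⟩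
    rw [← mul_sub, add_sub_cancel_left] at h
    exact ((Nat.prime_iff_prime_int.mp hp).dvd_or_dvd h).elim hpa hWt
  have hcard := eventually_mul_le_card_largePrimeFactors hdeg (S := S)
    (fun t p hp hpt => ⟨hS t p hp hpt, (hprime t p hp hpt).2.2.1, (hprime t p hp hpt).2.2.2.1⟩)
    (fun p hp => hp.2.1) hlow (eventually_sum_log_div_le fun p hp => ⟨hp.1, hp.2.2⟩)
  refine exists_forall_infinite_of_prime_pairs hf
    (D := {p | p.Prime ∧ ∃ x : ℤ, (p : ℤ) ∣ f.eval x}) (fun p hp => hp)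
    (not_summable_indicator_of_finite_diff (not_summable_indicator_normPrimes K)
      ((Set.finite_Iic a.natAbs).subset ?_)) hW hcard fun t p _ hp hpt => ?_
  · rintro p ⟨hpK, hpD⟩
    rw [Set.mem_Iic]
    by_contra! hlt
    have hp := hpK.1
    obtain ⟨y, hy⟩ := exists_dvd_eval_minpoly_of_mem_normPrimes β hpK
    rw [hβ] at hy
    have hp' := Nat.prime_iff_prime_int.mp hp
    have hpa : ¬ (p : ℤ) ∣ a := fun h =>
      hlt.not_ge (Nat.le_of_dvd (Int.natAbs_pos.mpr ha) (Int.natCast_dvd.mp h))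
    obtain ⟨u, v, huv⟩ := hp'.coprime_iff_not_dvd.mpr hpa
    have h1 : (p : ℤ) ∣ F.eval (a * (v * y)) :=
      dvd_eval_of_dvd_sub ⟨-(u * y), by linear_combination y * huv⟩ hy
    rw [hFf] at h1
    exact hpD ⟨hp, v * y, (hp'.dvd_or_dvd h1).resolve_left fun h => hpa (hp'.dvd_of_dvd_pow h)⟩
  · obtain ⟨-, -, -, -, x, hx, hy⟩ := hprime t p hp hpt
    exact ⟨x, hx, by exact_mod_cast hy⟩

theorem exists_roots_of_quadratic {k : Type*} [Field k] {a b c w : k} (h2 : (2 : k) ≠ 0)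
    (ha : a ≠ 0) (h : a ^ 2 * w ^ 2 - (b ^ 2 - 4 * a * c) = 0) :
    ∃ x, a * x ^ 2 + b * x + c = 0 ∧ a * (x + w) ^ 2 + b * (x + w) + c = 0 := by
  refine ⟨(-b - a * w) / (2 * a), ?_, ?_⟩
  · field_simp
    linear_combination h
  · field_simp
    linear_combination h

theorem exists_roots_of_depressed_cubic {k : Type*} [Field k] {A B d : k} (h2 : (2 : k) ≠ 0)
    (hA : d ^ 2 + A ≠ 0) (h : d ^ 2 * (d ^ 2 + 3 * A) ^ 2 + (4 * A ^ 3 + 27 * B ^ 2) = 0) :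
    ∃ y, y ^ 3 + A * y + B = 0 ∧ (y + d) ^ 3 + A * (y + d) + B = 0 := by
  refine ⟨-(d ^ 3 + A * d + 3 * B) / (2 * (d ^ 2 + A)), ?_, ?_⟩
  · field_simp
    linear_combination (-d^3 - A * d - B) * h
  · field_simp
    linear_combination (d^3 + A * d - B) * h

theorem exists_roots_of_cubic {k : Type*} [Field k] {a b c e w : k} (h2 : (2 : k) ≠ 0)
    (h3 : (3 : k) ≠ 0) (ha : a ≠ 0) {A B d : k} (hA' : A = 9 * a * c - 3 * b ^ 2)
    (hB' : B = 27 * a ^ 2 * e - 9 * a * b * c + 2 * b ^ 3) (hd : d = 3 * a * w)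
    (hA : d ^ 2 + A ≠ 0) (h : d ^ 2 * (d ^ 2 + 3 * A) ^ 2 + (4 * A ^ 3 + 27 * B ^ 2) = 0) :
    ∃ x, a * x ^ 3 + b * x ^ 2 + c * x + e = 0 ∧
      a * (x + w) ^ 3 + b * (x + w) ^ 2 + c * (x + w) + e = 0 := by
  obtain ⟨y, h0, h1⟩ := exists_roots_of_depressed_cubic h2 hA h
  have h27 : 27 * a ^ 2 ≠ 0 := by
    have : (27 : k) = 3 ^ 3 := by norm_num
    rw [this]
    exact mul_ne_zero (pow_ne_zero _ h3) (pow_ne_zero _ ha)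
  have hx : 3 * a * ((y - b) / (3 * a)) = y - b := by field_simp
  generalize (y - b) / (3 * a) = x at hx
  have hy : y = 3 * a * x + b := by linear_combination -hx
  subst hy hA' hB' hd
  refine ⟨x, ?_, ?_⟩
  · refine (mul_eq_zero_iff_left h27).mp ?_
    linear_combination h0
  · refine (mul_eq_zero_iff_left h27).mp ?_
    linear_combination h1

theorem irreducible_map_of_forall_eval_ne_zero {F : ℤ[X]} (hF : F.Monic) (h2 : 2 ≤ F.natDegree)
    (h3 : F.natDegree ≤ 3) (hroot : ∀ q : ℚ, eval q (F.map (Int.castRingHom ℚ)) ≠ 0) :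
    Irreducible (F.map (Int.castRingHom ℚ)) := by
  have hdeg : (F.map (Int.castRingHom ℚ)).natDegree = F.natDegree := hF.natDegree_map _
  refine ((hF.map _).irreducible_iff_roots_eq_zero_of_degree_le_three (by omega) (by omega)).mpr ?_
  rw [Multiset.eq_zero_iff_forall_notMem]
  exact fun q hq => hroot q (isRoot_of_mem_roots hq)

theorem exists_forall_infinite_of_quadratic {a b c : ℤ} (ha : a ≠ 0)
    (hroot : ∀ q : ℚ, a * q ^ 2 + b * q + c ≠ 0) :
    ∃ G : ℕ, 2 ≤ G ∧ ∀ k : ℕ, G ≤ k →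
      {n : ℕ | ∀ i ∈ Finset.Icc 1 k, ∃ j ∈ Finset.Icc 1 k, j ≠ i ∧
        1 < Int.gcd ((C a * X ^ 2 + C b * X + C c : ℤ[X]).eval ((n + i : ℕ) : ℤ))
          ((C a * X ^ 2 + C b * X + C c : ℤ[X]).eval ((n + j : ℕ) : ℤ))}.Infinite := by
  have ha' : (a : ℚ) ≠ 0 := by exact_mod_cast ha
  set Δ : ℤ := b ^ 2 - 4 * a * c with hΔ
  have hΔ0 : Δ ≠ 0 := by
    intro h
    have h' : (b : ℚ) ^ 2 - 4 * a * c = 0 := by exact_mod_cast h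
    refine hroot (-b / (2 * a)) ?_
    field_simp
    linear_combination -h'
  have hdegF : (X ^ 2 + C b * X + C (a * c) : ℤ[X]).natDegree = 2 := by compute_degree!
  have hF : (X ^ 2 + C b * X + C (a * c) : ℤ[X]).Monic := by
    monicity!
  have hirr := irreducible_map_of_forall_eval_ne_zero hF hdegF.ge (by omega) fun q hq => by
    refine hroot (q / a) ?_
    simp only [eval_map, eval₂_add, eval₂_mul, eval₂_pow, eval₂_X, eval₂_C] at hq
    simp only [eq_intCast, Int.cast_mul] at hq
    field_simp
    linear_combination hq
  have hf : (C a * X ^ 2 + C b * X + C c : ℤ[X]) ≠ 0 := by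
    refine ne_zero_of_natDegree_gt (n := 1) ?_
    have : (C a * X ^ 2 + C b * X + C c : ℤ[X]).natDegree = 2 := by compute_degree!
    omega
  refine exists_forall_infinite_of_irreducible hf hF hirr ha (e := 1)
    (fun x => by simp; ring) fun N hN => ?_
  set M : ℤ := 2 * a * N with hM
  have hM0 : M ≠ 0 := by positivity
  refine ⟨C (Δ * (a * M) ^ 2) * X ^ 2 - 1, (Δ * M).natAbs, ?_, ?_⟩
  · positivity
  have hdegP : (C (Δ * (a * M) ^ 2) * X ^ 2 - 1 : ℤ[X]).natDegree = 2 := by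
    compute_degree!
  have heval : ∀ t : ℤ, (C (Δ * (a * M) ^ 2) * X ^ 2 - 1 : ℤ[X]).eval t =
      Δ * (a * M) ^ 2 * t ^ 2 - 1 := fun t => by simp
  refine ⟨by omega, fun t ht => ?_, fun t p hp hpt => ?_⟩
  · rw [hdegP, heval]
    zify
    have h1 : 2 ≤ |Δ * (a * M) ^ 2| := by
      have h4 : Δ * (a * M) ^ 2 = 2 * (Δ * (a ^ 3 * N) * M) := by rw [hM]; ring
      have h5 : Δ * (a ^ 3 * N) * M ≠ 0 := by positivity
      rw [h4, abs_mul, abs_two]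
      have := Int.one_le_abs h5
      omega
    have h2 : |Δ * (a * M) ^ 2 * t ^ 2| - |1| ≤ |Δ * (a * M) ^ 2 * t ^ 2 - 1| :=
      abs_sub_abs_le_abs_sub _ _
    rw [abs_mul, abs_one, abs_of_nonneg (sq_nonneg (t : ℤ))] at h2
    have h3 : 1 ≤ (t : ℤ) ^ 2 := by exact_mod_cast Nat.one_le_pow _ _ ht
    nlinarith
  · have hp' := Nat.prime_iff_prime_int.mp hp
    rw [heval] at hpt
    have key : ∀ z : ℤ, z ∣ Δ * (a * M) ^ 2 * t ^ 2 → ¬ (p : ℤ) ∣ z := fun z hz hpz =>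
      hp'.not_dvd_one ((dvd_sub_right (hpz.trans hz)).mp hpt)
    have hpM : ¬ (p : ℤ) ∣ M := key M ⟨Δ * a ^ 2 * M * t ^ 2, by ring⟩
    have hp2 : ¬ (p : ℤ) ∣ 2 := fun h => hpM (h.trans ⟨a * N, by rw [hM]; ring⟩)
    have hpa : ¬ (p : ℤ) ∣ a := fun h => hpM (h.trans ⟨2 * N, by rw [hM]; ring⟩)
    have hpN : ¬ (p : ℤ) ∣ N := fun h => hpM (h.trans ⟨2 * a, by rw [hM]; ring⟩)
    have hpt' : ¬ (p : ℤ) ∣ t := key t ⟨Δ * (a * M) ^ 2 * t, by ring⟩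
    have hpΔ : ¬ (p : ℤ) ∣ Δ := key Δ ⟨(a * M) ^ 2 * t ^ 2, by ring⟩
    refine ⟨by exact_mod_cast hpN, ?_, ?_, ?_, ?_⟩
    · rw [hp'.dvd_mul, Int.natCast_dvd_natCast, ← Int.natCast_dvd, hp'.dvd_mul]
      tauto
    · simp only [derivative_sub, derivative_C_mul, derivative_X_pow, derivative_one]
      simp only [eval_mul, eval_C, eval_pow, eval_X, sub_zero]
      rw [hp'.dvd_mul, hp'.dvd_mul, hp'.dvd_mul, hp'.dvd_pow_iff_dvd two_ne_zero, hp'.dvd_mul]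
      have h2 : ¬ (p : ℤ) ∣ ((2 : ℕ) : ℤ) := by exact_mod_cast hp2
      have h3 : ¬ (p : ℤ) ∣ t ^ (2 - 1) := by rwa [Nat.add_one_sub_one, pow_one]
      tauto
    · rw [heval]
      simpa using hp'.not_dvd_one
    · have : Fact p.Prime := ⟨hp⟩
      have hcast : ∀ z : ℤ, ¬ (p : ℤ) ∣ z → (z : ZMod p) ≠ 0 := fun z hz h =>
        hz ((ZMod.intCast_zmod_eq_zero_iff_dvd _ _).mp h)
      set w : ℤ := ((Δ * M).natAbs : ℤ) * t with hw
      have hw2 : w ^ 2 = Δ ^ 2 * M ^ 2 * t ^ 2 := by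
        rw [hw, mul_pow, Int.natCast_natAbs, sq_abs]; ring
      have h0 : a ^ 2 * w ^ 2 - (b ^ 2 - 4 * a * c) = Δ * (Δ * (a * M) ^ 2 * t ^ 2 - 1) := by
        rw [← hΔ, hw2]; ring
      obtain ⟨x, hx, hy⟩ := exists_roots_of_quadratic (k := ZMod p) (a := a) (b := b) (c := c)
        (w := w) (by exact_mod_cast hcast 2 hp2) (hcast a hpa) (by
          have := (ZMod.intCast_zmod_eq_zero_iff_dvd _ p).mpr (h0 ▸ hpt.mul_left Δ)
          exact_mod_cast this)
      obtain ⟨x, rfl⟩ := ZMod.intCast_surjective x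
      refine ⟨x, (ZMod.intCast_zmod_eq_zero_iff_dvd _ p).mp ?_,
        (ZMod.intCast_zmod_eq_zero_iff_dvd _ p).mp ?_⟩
      · rw [← hx]; simp
      · rw [← hy]; simp

theorem exists_polynomial_eval_eq {δ u : ℤ} (hδ : δ ≠ 0) (hu : u ≠ 0) (A : ℤ) :
    ∃ P : ℤ[X], P.natDegree = 6 ∧
      (∀ t : ℤ, P.eval t = δ * (u * t) ^ 2 * ((δ * u * t) ^ 2 + 3 * A) ^ 2 + 1) ∧
      ∀ t : ℤ, P.derivative.eval t =
        u * 6 * (δ * u * t) * ((δ * u * t) ^ 2 + A) * ((δ * u * t) ^ 2 + 3 * A) := by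
  refine ⟨C (δ ^ 5 * u ^ 6) * X ^ 6 + C (6 * A * δ ^ 3 * u ^ 4) * X ^ 4 +
    C (9 * A ^ 2 * δ * u ^ 2) * X ^ 2 + 1, ?_, fun t => ?_, fun t => ?_⟩
  · compute_degree!
  · simp only [eval_add, eval_mul, eval_C, eval_pow, eval_X, eval_one]
    ring
  · simp only [derivative_add, derivative_C_mul, derivative_X_pow, derivative_one, eval_add,
      eval_mul, eval_C, eval_pow, eval_X, eval_zero]
    norm_num
    ring

theorem pow_six_le_abs {δ u A t : ℤ} (hδ : δ ≠ 0) (hu : 6 * (1 + |A|) ≤ |u|) (ht : 1 ≤ t) :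
    t ^ 6 ≤ |δ * (u * t) ^ 2 * ((δ * u * t) ^ 2 + 3 * A) ^ 2 + 1| := by
  have hA := abs_nonneg A
  have hA' := neg_abs_le A
  have ht2 : 1 ≤ t ^ 2 := one_le_pow₀ ht
  have hu2 : 36 * (1 + |A|) ≤ u ^ 2 := by
    rw [← sq_abs]
    nlinarith
  have hX : 36 * (1 + |A|) * t ^ 2 ≤ (u * t) ^ 2 := by
    rw [mul_pow]
    gcongr
  have hδ1 := Int.one_le_abs hδ
  have hδ2 : 1 ≤ δ ^ 2 := by
    rw [← sq_abs]
    exact one_le_pow₀ hδ1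
  have hY : t ^ 2 ≤ (δ * u * t) ^ 2 + 3 * A := by
    have h1 : (δ * u * t) ^ 2 = δ ^ 2 * (u * t) ^ 2 := by ring
    nlinarith [sq_nonneg (u * t)]
  have hY2 : (t ^ 2) ^ 2 ≤ ((δ * u * t) ^ 2 + 3 * A) ^ 2 := by gcongr
  have hX2 : 36 * t ^ 2 ≤ (u * t) ^ 2 := by nlinarith
  have h1 : 1 * (36 * t ^ 2) * (t ^ 2) ^ 2 ≤
      |δ| * (u * t) ^ 2 * ((δ * u * t) ^ 2 + 3 * A) ^ 2 := by gcongr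
  have h2 : |δ * (u * t) ^ 2 * ((δ * u * t) ^ 2 + 3 * A) ^ 2| - |-1| ≤
      |δ * (u * t) ^ 2 * ((δ * u * t) ^ 2 + 3 * A) ^ 2 - -1| := abs_sub_abs_le_abs_sub _ _
  rw [abs_mul, abs_mul, abs_pow (u * t), sq_abs, abs_pow ((δ * u * t) ^ 2 + 3 * A), sq_abs, abs_neg,
    abs_one, sub_neg_eq_add] at h2
  have h3 : 1 ≤ t ^ 6 := one_le_pow₀ ht
  linarith

theorem exists_forall_infinite_of_cubic {a b c e : ℤ} (ha : a ≠ 0)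
    (hroot : ∀ q : ℚ, a * q ^ 3 + b * q ^ 2 + c * q + e ≠ 0) :
    ∃ G : ℕ, 2 ≤ G ∧ ∀ k : ℕ, G ≤ k →
      {n : ℕ | ∀ i ∈ Finset.Icc 1 k, ∃ j ∈ Finset.Icc 1 k, j ≠ i ∧
        1 < Int.gcd ((C a * X ^ 3 + C b * X ^ 2 + C c * X + C e : ℤ[X]).eval ((n + i : ℕ) : ℤ))
          ((C a * X ^ 3 + C b * X ^ 2 + C c * X + C e : ℤ[X]).eval
            ((n + j : ℕ) : ℤ))}.Infinite := by
  have ha' : (a : ℚ) ≠ 0 := by exact_mod_cast ha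
  set A : ℤ := 9 * a * c - 3 * b ^ 2 with hA
  set B : ℤ := 27 * a ^ 2 * e - 9 * a * b * c + 2 * b ^ 3 with hB
  set δ : ℤ := 4 * A ^ 3 + 27 * B ^ 2 with hδ
  clear_value δ B A
  have hroot' : ∀ y : ℚ, y ^ 3 + A * y + B ≠ 0 := by
    intro y hy
    refine hroot ((y - b) / (3 * a)) ?_
    rw [hA, hB] at hy
    push_cast at hy
    field_simp
    linear_combination hy
  have hB0 : B ≠ 0 := by
    intro h
    refine hroot' 0 ?_
    rw [h]
    norm_num
  have hδ0 : δ ≠ 0 := by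
    intro h
    have h' : 4 * (A : ℚ) ^ 3 + 27 * B ^ 2 = 0 := by rw [hδ] at h; exact_mod_cast h
    have hA0 : (A : ℚ) ≠ 0 := by
      intro h0
      rw [h0] at h'
      refine hB0 ?_
      have : (B : ℚ) = 0 := by simpa using h'
      exact_mod_cast this
    refine hroot' (3 * B / A) ?_
    field_simp
    linear_combination B * h'
  have hdegF : (X ^ 3 + C b * X ^ 2 + C (a * c) * X + C (a ^ 2 * e) : ℤ[X]).natDegree = 3 := by
    compute_degree!
  have hF : (X ^ 3 + C b * X ^ 2 + C (a * c) * X + C (a ^ 2 * e) : ℤ[X]).Monic := by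
    monicity!
  have hirr := irreducible_map_of_forall_eval_ne_zero hF (by omega) hdegF.le fun q hq => by
    refine hroot (q / a) ?_
    simp only [eval_map, eval₂_add, eval₂_mul, eval₂_pow, eval₂_X, eval₂_C] at hq
    simp only [eq_intCast, Int.cast_mul, Int.cast_pow] at hq
    field_simp
    linear_combination hq
  have hf : (C a * X ^ 3 + C b * X ^ 2 + C c * X + C e : ℤ[X]) ≠ 0 := by
    refine ne_zero_of_natDegree_gt (n := 2) ?_
    have : (C a * X ^ 3 + C b * X ^ 2 + C c * X + C e : ℤ[X]).natDegree = 3 := by compute_degree!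
    omega
  refine exists_forall_infinite_of_irreducible hf hF hirr ha (e := 2)
    (fun x => by simp; ring) fun N hN => ?_
  set M : ℤ := 6 * B * (1 + |A|) * N with hM
  have hA1 : 0 < 1 + |A| := by positivity
  have hM0 : M ≠ 0 := by positivity
  set u : ℤ := 3 * a * M with hu
  have hu0 : u ≠ 0 := by positivity
  clear_value u M
  have huA : 6 * (1 + |A|) ≤ |u| := by
    have h : u = 6 * (1 + |A|) * (3 * a * B * N) := by rw [hu, hM]; ring
    have h0 : 3 * a * B * N ≠ 0 := by positivity
    have h6 : 0 ≤ 6 * (1 + |A|) := by omega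
    rw [h, abs_mul, abs_of_nonneg h6]
    exact le_mul_of_one_le_right h6 (Int.one_le_abs h0)
  obtain ⟨P, hdegP, heval, hderiv⟩ := exists_polynomial_eval_eq hδ0 hu0 A
  refine ⟨P, (δ * M).natAbs, by positivity, by omega, fun t ht => ?_, fun t p hp hpt => ?_⟩
  · rw [hdegP, heval]
    zify
    exact pow_six_le_abs hδ0 huA (by exact_mod_cast ht)
  · have hp' := Nat.prime_iff_prime_int.mp hp
    rw [heval] at hpt
    have key : ∀ z : ℤ, z ∣ δ * (u * t) ^ 2 * ((δ * u * t) ^ 2 + 3 * A) ^ 2 → ¬ (p : ℤ) ∣ z :=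
      fun z hz hpz => hp'.not_dvd_one ((dvd_add_right (hpz.trans hz)).mp hpt)
    have hpδ : ¬ (p : ℤ) ∣ δ := key δ ⟨_, mul_assoc _ _ _⟩
    have hpA3 : ¬ (p : ℤ) ∣ (δ * u * t) ^ 2 + 3 * A :=
      key _ ⟨δ * (u * t) ^ 2 * ((δ * u * t) ^ 2 + 3 * A), by ring⟩
    have hput : ¬ (p : ℤ) ∣ u * t :=
      key _ ⟨δ * (u * t) * ((δ * u * t) ^ 2 + 3 * A) ^ 2, by ring⟩
    rw [hp'.dvd_mul, not_or] at hput
    obtain ⟨hpu, hpt'⟩ := hput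
    have hpuM := hpu
    rw [hu, hp'.dvd_mul, hp'.dvd_mul, not_or, not_or] at hpuM
    obtain ⟨⟨hp3, hpa⟩, hpM⟩ := hpuM
    have hpMN := hpM
    rw [hM, hp'.dvd_mul, hp'.dvd_mul, hp'.dvd_mul, not_or, not_or, not_or] at hpMN
    obtain ⟨⟨⟨hp6, hpB⟩, -⟩, hpN⟩ := hpMN
    have hp2 : ¬ (p : ℤ) ∣ 2 := fun h => hp6 (h.trans ⟨3, by norm_num⟩)
    have hG : ∀ D : ℤ, D ^ 2 = (δ * u * t) ^ 2 →
        (p : ℤ) ∣ D ^ 2 * (D ^ 2 + 3 * A) ^ 2 + (4 * A ^ 3 + 27 * B ^ 2) := by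
      intro D hD
      refine (hpt.mul_left δ).trans (dvd_of_eq ?_)
      rw [hD, ← hδ]
      ring
    have hpA : ¬ (p : ℤ) ∣ (δ * u * t) ^ 2 + A := by
      intro h
      have h1 : (p : ℤ) ∣ 3 ^ 3 * B ^ 2 := by
        have h2 := hG _ rfl
        have h3 : (δ * u * t) ^ 2 * ((δ * u * t) ^ 2 + 3 * A) ^ 2 + (4 * A ^ 3 + 27 * B ^ 2) =
          3 ^ 3 * B ^ 2 + ((δ * u * t) ^ 2 + A) *
            ((δ * u * t) ^ 4 + 5 * A * (δ * u * t) ^ 2 + 4 * A ^ 2) := by ring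
        rw [h3] at h2
        exact (dvd_add_left (h.mul_right _)).mp h2
      rcases hp'.dvd_or_dvd h1 with h1 | h1
      · exact hp3 (hp'.dvd_of_dvd_pow h1)
      · exact hpB (hp'.dvd_of_dvd_pow h1)
    refine ⟨by exact_mod_cast hpN, ?_, ?_, ?_, ?_⟩
    · rw [hp'.dvd_mul, Int.natCast_dvd_natCast, ← Int.natCast_dvd, hp'.dvd_mul]
      tauto
    · rw [hderiv, hp'.dvd_mul, hp'.dvd_mul, hp'.dvd_mul, hp'.dvd_mul, hp'.dvd_mul, hp'.dvd_mul]
      tauto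
    · rw [heval]
      simpa using hp'.not_dvd_one
    · have : Fact p.Prime := ⟨hp⟩
      have hcast : ∀ z : ℤ, ¬ (p : ℤ) ∣ z → (z : ZMod p) ≠ 0 := fun z hz h =>
        hz ((ZMod.intCast_zmod_eq_zero_iff_dvd _ _).mp h)
      set w : ℤ := ((δ * M).natAbs : ℤ) * t with hw
      have hw2 : (3 * a * w) ^ 2 = (δ * u * t) ^ 2 := by
        rw [hw, mul_pow, mul_pow _ t, Int.natCast_natAbs, sq_abs, hu]; ring
      obtain ⟨x, hx, hy⟩ := exists_roots_of_cubic (k := ZMod p) (a := a) (b := b) (c := c) (e := e)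
        (w := w) (A := A) (B := B) (d := ((3 * a * w : ℤ) : ZMod p))
        (by exact_mod_cast hcast 2 hp2) (by exact_mod_cast hcast 3 hp3) (hcast a hpa)
        (by rw [hA]; push_cast; rfl) (by rw [hB]; push_cast; rfl) (by push_cast; rfl)
        (by exact_mod_cast hcast _ (hw2 ▸ hpA)) (by
          have := (ZMod.intCast_zmod_eq_zero_iff_dvd _ p).mpr (hG _ hw2)
          exact_mod_cast this)
      obtain ⟨x, rfl⟩ := ZMod.intCast_surjective x
      refine ⟨x, (ZMod.intCast_zmod_eq_zero_iff_dvd _ p).mp ?_,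
        (ZMod.intCast_zmod_eq_zero_iff_dvd _ p).mp ?_⟩
      · rw [← hx]; simp
      · rw [← hy]; simp

open Filter in
theorem eventually_mul_sqrt_le_primeCounting_sub (C : ℝ) :
    ∀ᶠ N : ℕ in atTop,
      C * √N ≤ Nat.primeCounting N - Nat.primeCounting (N / 16) := by
  have hdiv : Tendsto (fun N : ℕ => N / 16) atTop atTop :=
    Nat.tendsto_div_const_atTop (by norm_num)
  have h1 := (tendsto_natCast_atTop_atTop.comp hdiv).eventually
    (Chebyshev.eventually_primeCounting_le one_pos)
  have h2 := (Real.isLittleO_log_id_atTop.bound (show (0 : ℝ) < 1 / 200 by norm_num))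
  have h3 := (isLittleO_log_rpow_atTop (show (0 : ℝ) < 1 / 2 by norm_num)).bound
    (show (0 : ℝ) < 3 / 10 / (|C| + 1) by positivity)
  filter_upwards [h1, tendsto_natCast_atTop_atTop.eventually h2,
    tendsto_natCast_atTop_atTop.eventually h3, eventually_ge_atTop 10000] with N h1 h2 h3 hN
  set n := N / 16 with hn
  have hN' : (10000 : ℝ) ≤ N := by exact_mod_cast hN
  have hlogN : 0 < Real.log N := Real.log_pos (by linarith)
  simp only [Function.comp_apply, Nat.floor_natCast, ← hn] at h1
  rw [Real.norm_of_nonneg hlogN.le, Real.norm_of_nonneg (by positivity)] at h2 h3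
  rw [← Real.sqrt_eq_rpow] at h3
  have hnN : (n : ℝ) ≤ N / 16 := by
    rw [le_div_iff₀ (by norm_num)]
    exact_mod_cast Nat.div_mul_le_self N 16
  have hNn : N ≤ n ^ 2 := by
    have : N ≤ 32 * n := by omega
    nlinarith
  have hn0 : 625 ≤ n := by omega
  have hlogn : Real.log N / 2 ≤ Real.log n := by
    have h4 : Real.log N ≤ Real.log ((n : ℝ) ^ 2) :=
      Real.log_le_log (by linarith) (by exact_mod_cast hNn)
    rw [Real.log_pow] at h4
    push_cast at h4
    linarith
  have hlog4 : Real.log 4 ≤ 14 / 10 := by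
    have : Real.log 4 = 2 * Real.log 2 := by
      rw [show (4 : ℝ) = 2 ^ 2 by norm_num, Real.log_pow]
      norm_num
    linarith [Real.log_two_lt_d9]
  have hupper : (Nat.primeCounting n : ℝ) ≤ 3 / 10 * N / Real.log N := by
    refine h1.trans ?_
    rw [div_le_div_iff₀ (by linarith) hlogN]
    have h5 : (Real.log 4 + 1) * n ≤ 24 / 10 * (N / 16) := by gcongr; linarith
    calc (Real.log 4 + 1) * n * Real.log N ≤ 24 / 10 * (N / 16) * (2 * Real.log n) := by
          gcongr
          linarith
      _ = _ := by ring
  have hlower : 6 / 10 * N / Real.log N ≤ Nat.primeCounting N := by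
    refine le_trans ?_ (Chebyshev.pi_ge N)
    gcongr
    have h6 : Real.log (N + 1) ≤ Real.log N + Real.log 2 := by
      rw [← Real.log_mul (by linarith) (by norm_num)]
      exact Real.log_le_log (by linarith) (by linarith)
    have h7 := Real.log_two_gt_d9
    have h8 := Real.log_two_lt_d9
    simp only [id] at h2
    nlinarith
  have hmain : C * √N ≤ 3 / 10 * N / Real.log N := by
    rw [le_div_iff₀ hlogN]
    calc C * √N * Real.log N ≤ (|C| + 1) * √N * (3 / 10 / (|C| + 1) * √N) := by
          gcongr
          linarith [le_abs_self C]
      _ = 3 / 10 * (√N * √N) := by field_simp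
      _ = 3 / 10 * N := by rw [Real.mul_self_sqrt (by positivity)]
  have : 6 / 10 * N / Real.log N = 3 / 10 * N / Real.log N + 3 / 10 * N / Real.log N := by ring
  linarith

open Classical in
theorem card_filter_forall_not_dvd_le (Y N : ℕ) :
    ((Finset.Icc 1 (N + 1)).filter fun n =>
      ∀ p : ℕ, p.Prime → Y ≤ p → p ≤ N / 16 → ¬ p ∣ n).card ≤
    (Nat.smoothNumbersUpTo (N + 1) Y).card +
      ((Finset.Ioc (N / 16) (N + 1)).filter Nat.Prime).card * 16 := by
  have hsub : (Finset.Icc 1 (N + 1)).filter (fun n =>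
      ∀ p : ℕ, p.Prime → Y ≤ p → p ≤ N / 16 → ¬ p ∣ n) ⊆
      Nat.smoothNumbersUpTo (N + 1) Y ∪
        (((Finset.Ioc (N / 16) (N + 1)).filter Nat.Prime) ×ˢ Finset.Icc 1 16).image
          fun q => q.1 * q.2 := by
    intro n hn
    simp only [Finset.mem_filter, Finset.mem_Icc] at hn
    obtain ⟨⟨hn1, hnN⟩, hn⟩ := hn
    rw [Finset.mem_union]
    by_cases h : n ∈ Nat.smoothNumbers Y
    · exact Or.inl (Nat.mem_smoothNumbersUpTo.mpr ⟨hnN, h⟩)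
    · right
      rw [Nat.mem_smoothNumbers'] at h
      push Not at h
      obtain ⟨p, hp, hpn, hYp⟩ := h
      have hNp : N / 16 < p := by
        by_contra! hle
        exact hn p hp hYp hle hpn
      have hpN : p ≤ N + 1 := (Nat.le_of_dvd hn1 hpn).trans hnN
      obtain ⟨m, rfl⟩ := hpn
      refine Finset.mem_image.mpr ⟨(p, m), ?_, rfl⟩
      simp only [Finset.mem_product, Finset.mem_filter, Finset.mem_Ioc, Finset.mem_Icc]
      refine ⟨⟨⟨hNp, hpN⟩, hp⟩, Nat.pos_of_mul_pos_left hn1, ?_⟩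
      by_contra! hm
      have h17 : p * 17 ≤ p * m := Nat.mul_le_mul_left p hm
      omega
  refine (Finset.card_le_card hsub).trans ((Finset.card_union_le _ _).trans ?_)
  gcongr
  refine Finset.card_image_le.trans ?_
  rw [Finset.card_product, Nat.card_Icc]

theorem card_filter_prime_Ioc {a b : ℕ} (h : a ≤ b) :
    ((Finset.Ioc a b).filter Nat.Prime).card + Nat.primeCounting a = Nat.primeCounting b := by
  rw [← Nat.card_primesLE, ← Nat.card_primesLE, ← Finset.card_union_of_disjoint]
  · congr 1
    ext p
    simp only [Finset.mem_union, Finset.mem_filter, Finset.mem_Ioc, Nat.mem_primesLE]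
    constructor
    · rintro (⟨⟨-, h1⟩, h2⟩ | ⟨h1, h2⟩)
      exacts [⟨h1, h2⟩, ⟨h1.trans h, h2⟩]
    · rintro ⟨h1, h2⟩
      rcases lt_or_ge a p with h3 | h3
      exacts [Or.inl ⟨⟨h3, h1⟩, h2⟩, Or.inr ⟨h3, h2⟩]
  · rw [Finset.disjoint_left]
    intro p hp hp'
    simp only [Finset.mem_filter, Finset.mem_Ioc, Nat.mem_primesLE] at hp hp'
    omega

theorem dvd_eval_of_dvd_mul_sub {f : ℤ[X]} {r s : ℤ} (hroot : (f.scaleRoots s).eval r = 0)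
    {p x : ℤ} (hp : Prime p) (hps : ¬ p ∣ s) (h : p ∣ s * x - r) : p ∣ f.eval x := by
  have h1 : p ∣ (f.scaleRoots s).eval (s * x) := dvd_eval_of_dvd_sub h (hroot ▸ dvd_zero p)
  rw [scaleRoots_eval_mul] at h1
  exact (hp.dvd_or_dvd h1).resolve_left fun h2 => hps (hp.dvd_of_dvd_pow h2)

theorem exists_dvd_mul_sub {p : ℕ} (hp : p.Prime) {s : ℤ} (hps : ¬ (p : ℤ) ∣ s) (r : ℤ) :
    ∃ x : ℤ, (p : ℤ) ∣ s * x - r := by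
  have h : IsCoprime (p : ℤ) s :=
    (Nat.prime_iff_prime_int.mp hp).irreducible.coprime_iff_not_dvd.mpr hps
  obtain ⟨u, v, huv⟩ := h
  exact ⟨v * r, -(u * r), by linear_combination r * huv⟩

open Filter in
theorem exists_forall_infinite_of_scaleRoots_eval_eq_zero {f : ℤ[X]} (hf : f ≠ 0) {r s : ℤ}
    (hs : s ≠ 0) (hroot : (f.scaleRoots s).eval r = 0) :
    ∃ G : ℕ, 2 ≤ G ∧ ∀ k : ℕ, G ≤ k →
      {n : ℕ | ∀ i ∈ Finset.Icc 1 k, ∃ j ∈ Finset.Icc 1 k, j ≠ i ∧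
        1 < Int.gcd (f.eval ((n + i : ℕ) : ℤ)) (f.eval ((n + j : ℕ) : ℤ))}.Infinite := by
  classical
  have hle : ∀ p : ℕ, (p : ℤ) ∣ s → p ≤ s.natAbs := fun p hp =>
    Nat.le_of_dvd (Int.natAbs_pos.mpr hs) (Int.natCast_dvd.mp hp)
  have hx : ∀ p : ℕ, p.Prime → ¬ (p : ℤ) ∣ s → ∃ x : ℤ, (p : ℤ) ∣ s * x - r :=
    fun p hp hps => exists_dvd_mul_sub hp hps r
  obtain ⟨S, hSD, hS⟩ := exists_finset_prod_one_sub_le (D := {p | p.Prime ∧ ¬ (p : ℤ) ∣ s})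
    (fun p hp => hp.1) (not_summable_indicator_of_finite_diff not_summable_one_div_on_primes <|
      (Set.finite_Iic s.natAbs).subset fun p hp => hle p <| by
        by_contra h
        exact hp.2 ⟨hp.1, h⟩) (show (0 : ℝ) < 1 / 128 by norm_num)
  obtain ⟨Y, hYS, hYs, hY0⟩ : ∃ Y, (∀ p ∈ S, p < Y) ∧ s.natAbs < Y ∧ 0 < Y :=
    ⟨S.sup id + s.natAbs + 1, fun p hp => by
      have : id p ≤ S.sup id := Finset.le_sup hp
      simp only [id] at this
      omega, by omega, by omega⟩
  have hYs' : ∀ p : ℕ, Y ≤ p → ¬ (p : ℤ) ∣ s := fun p hp h => by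
    have := hle p h
    omega
  obtain ⟨q, hYq, hq⟩ := Nat.exists_infinite_primes Y
  set W : ℕ := 2 ^ Y.primesBelow.card with hW
  obtain ⟨N₀, hN₀⟩ := eventually_atTop.mp
    (eventually_mul_sqrt_le_primeCounting_sub (4 * W + 32))
  refine ⟨2 * (N₀ + 16 * q + 1), by omega, fun k hk => ?_⟩
  set N := k / 2 with hN
  have hN1 : N₀ ≤ N := by omega
  have hqN : q ≤ N / 16 := by omega
  have hNpos : 1 ≤ N := by omega
  specialize hN₀ N hN1
  choose! x hx using hx
  set M := (Finset.Icc Y (N / 16)).filter Nat.Prime with hM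
  set T := (Finset.Ioc (N / 16) N).filter Nat.Prime with hT
  have hcovered : ∀ p : ℕ, p.Prime → ¬ (p : ℤ) ∣ s → p ≤ N → ∀ i ∈ Finset.Icc 1 k, ∀ m : ℤ,
      (p : ℤ) ∣ i - m → i ∈ coveredBy f k p (x p - m) := by
    intro p hp hps hpN i hi m hm
    refine mem_coveredBy_of_dvd_sub hp.pos (by omega) hi
      (dvd_eval_of_dvd_mul_sub hroot (Nat.prime_iff_prime_int.mp hp) hps ?_)
    rw [show s * (x p - m + i) - r = (s * x p - r) + s * (i - m) by ring]
    exact dvd_add (hx p hp hps) (hm.mul_left s)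
  set B := (Finset.Icc 1 (N + 1)).filter fun n =>
    ∀ p : ℕ, p.Prime → Y ≤ p → p ≤ N / 16 → ¬ p ∣ n with hB
  set R := (Finset.Icc 1 k).filter fun i => ∀ p ∈ M, i ∉ coveredBy f k p (x p - N) with hR
  have hRB : R ⊆ B.image (fun m => N + m) ∪ B.image (fun m => N - m) := by
    intro i hi
    rw [hR, Finset.mem_filter] at hi
    obtain ⟨hi, hiM⟩ := hi
    have hndvd : ∀ p : ℕ, p.Prime → Y ≤ p → p ≤ N / 16 → ¬ (p : ℤ) ∣ i - N :=
      fun p hp hYp hpN h =>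
        hiM p (Finset.mem_filter.mpr ⟨Finset.mem_Icc.mpr ⟨hYp, hpN⟩, hp⟩)
          (hcovered p hp (hYs' p hYp) (by omega) i hi N h)
    have hmem : ((i : ℤ) - N).natAbs ∈ B := by
      have h0 : (i : ℤ) - N ≠ 0 := fun h => hndvd q hq hYq hqN (h ▸ dvd_zero _)
      rw [Finset.mem_Icc] at hi
      rw [hB, Finset.mem_filter, Finset.mem_Icc]
      exact ⟨by omega, fun p hp hYp hpN h => hndvd p hp hYp hpN (Int.natCast_dvd.mpr h)⟩
    rw [Finset.mem_Icc] at hi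
    rw [Finset.mem_union, Finset.mem_image, Finset.mem_image]
    rcases le_total N i with h | h
    · exact Or.inl ⟨_, hmem, by omega⟩
    · exact Or.inr ⟨_, hmem, by omega⟩
  have hTcard : (T.card : ℝ) = Nat.primeCounting N - Nat.primeCounting (N / 16) := by
    rw [← card_filter_prime_Ioc (Nat.div_le_self N 16)]
    push_cast
    ring
  have hTcard' : ((Finset.Ioc (N / 16) (N + 1)).filter Nat.Prime).card ≤ T.card + 1 := by
    rw [← Finset.insert_Ioc_right_eq_Ioc_add_one (by omega), Finset.filter_insert]
    split_ifs
    · exact Finset.card_insert_le _ _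
    · exact Nat.le_succ _
  have hRcard : (R.card : ℝ) ≤ 2 * (W * (2 * √N) + (T.card + 1) * 16) := by
    have h1 : R.card ≤ 2 * B.card :=
      calc R.card ≤ _ := (Finset.card_le_card hRB).trans (Finset.card_union_le _ _)
        _ ≤ B.card + B.card := add_le_add Finset.card_image_le Finset.card_image_le
        _ = _ := by ring
    have h2 : B.card ≤ W * (N + 1).sqrt + (T.card + 1) * 16 := by
      refine (card_filter_forall_not_dvd_le Y N).trans ?_
      gcongr
      exact Nat.smoothNumbersUpTo_card_le _ _
    have h3 : ((N + 1).sqrt : ℝ) ≤ 2 * √N := by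
      refine Real.nat_sqrt_le_real_sqrt.trans (Real.sqrt_le_iff.mpr ⟨by positivity, ?_⟩)
      rw [mul_pow, Real.sq_sqrt (by positivity)]
      have : (1 : ℝ) ≤ N := by exact_mod_cast hNpos
      push_cast
      linarith
    calc (R.card : ℝ) ≤ 2 * (W * (N + 1).sqrt + (T.card + 1) * 16) := by
          exact_mod_cast h1.trans (Nat.mul_le_mul_left 2 h2)
      _ ≤ _ := by gcongr
  refine infinite_of_sieve hf M S T ?_ ?_ ?_ ?_ (fun p => x p - N) ?_ ?_ R
    (Finset.filter_subset _ _) ?_ ?_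
  · rw [Finset.disjoint_left]
    intro p hp hpS
    have := hYS p hpS
    simp only [hM, Finset.mem_filter, Finset.mem_Icc] at hp
    omega
  · rw [Finset.disjoint_left]
    intro p hp hpT
    simp only [hM, hT, Finset.mem_filter, Finset.mem_Icc, Finset.mem_Ioc] at hp hpT
    omega
  · rw [Finset.disjoint_left]
    intro p hpS hpT
    have := hYS p hpS
    simp only [hT, Finset.mem_filter, Finset.mem_Ioc] at hpT
    omega
  · exact fun p hp => (Finset.mem_filter.mp hp).2
  · intro p hp
    have h1 := hYS p hp
    have h2 := hSD p hp
    exact ⟨h2.1, by omega, x p, dvd_eval_of_dvd_mul_sub hroot (Nat.prime_iff_prime_int.mp h2.1) h2.2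
      (hx p h2.1 h2.2)⟩
  · intro p hp
    simp only [hT, Finset.mem_filter, Finset.mem_Ioc] at hp
    exact ⟨hp.2, fun i hi => ⟨x p - i, hcovered p hp.2 (hYs' p (by omega)) hp.1.2 i hi i (by simp)⟩⟩
  · intro i hi hiR
    by_contra! h
    exact hiR (Finset.mem_filter.mpr ⟨hi, h⟩)
  · have h1 : (1 : ℝ) ≤ √N := Real.one_le_sqrt.mpr (by exact_mod_cast hNpos)
    rw [← hTcard] at hN₀
    calc (R.card : ℝ) * ∏ p ∈ S, (1 - 1 / (p : ℝ)) ≤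
        2 * (W * (2 * √N) + (T.card + 1) * 16) * (1 / 128) := by
          gcongr
          exact Finset.prod_nonneg fun p hp => one_sub_one_div_prime_nonneg (hSD p hp).1
      _ ≤ T.card := by linarith

theorem exists_forall_infinite_of_rat_root {f : ℤ[X]} (hf : f ≠ 0) {q : ℚ}
    (hq : aeval q f = 0) :
    ∃ G : ℕ, 2 ≤ G ∧ ∀ k : ℕ, G ≤ k →
      {n : ℕ | ∀ i ∈ Finset.Icc 1 k, ∃ j ∈ Finset.Icc 1 k, j ≠ i ∧
        1 < Int.gcd (f.eval ((n + i : ℕ) : ℤ)) (f.eval ((n + j : ℕ) : ℤ))}.Infinite := by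
  refine exists_forall_infinite_of_scaleRoots_eval_eq_zero hf (r := q.num) (s := q.den)
    (by exact_mod_cast q.den_ne_zero) ?_
  have h := scaleRoots_aeval_eq_zero (r := (q.den : ℤ)) hq
  have h1 : algebraMap ℤ ℚ (q.den : ℤ) * q = algebraMap ℤ ℚ q.num := by
    simp [Rat.den_mul_eq_num]
  rw [h1, aeval_algebraMap_apply] at h
  simpa using h

/-- For a quadratic or cubic `f ∈ ℤ[X]`, there exists `G ≥ 2` such that for every `k ≥ G`
there are infinitely many `n ≥ 0` with: none of `f(n+1), …, f(n+k)` is coprime to all the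
others. -/
theorem stmt_0 (f : Polynomial ℤ) (hdeg : f.natDegree = 2 ∨ f.natDegree = 3) :
    ∃ G : ℕ, 2 ≤ G ∧ ∀ k : ℕ, G ≤ k →
      {n : ℕ | ∀ i ∈ Finset.Icc 1 k, ∃ j ∈ Finset.Icc 1 k, j ≠ i ∧
        1 < Int.gcd (f.eval ((n + i : ℕ) : ℤ)) (f.eval ((n + j : ℕ) : ℤ))}.Infinite := by
  have hf : f ≠ 0 := by
    rintro rfl
    simp at hdeg
  by_cases hroot : ∃ q : ℚ, aeval q f = 0
  · obtain ⟨q, hq⟩ := hroot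
    exact exists_forall_infinite_of_rat_root hf hq
  push Not at hroot
  rcases hdeg with hdeg | hdeg
  · have hf' : f = C (f.coeff 2) * X ^ 2 + C (f.coeff 1) * X + C (f.coeff 0) := by
      conv_lhs => rw [f.as_sum_range_C_mul_X_pow, hdeg]
      simp only [Finset.sum_range_succ, Finset.sum_range_zero]
      ring
    have ha : f.coeff 2 ≠ 0 := hdeg ▸ leadingCoeff_ne_zero.mpr hf
    rw [hf'] at hroot ⊢
    exact exists_forall_infinite_of_quadratic ha fun q => by simpa using hroot q
  · have hf' : f = C (f.coeff 3) * X ^ 3 + C (f.coeff 2) * X ^ 2 + C (f.coeff 1) * X +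
        C (f.coeff 0) := by
      conv_lhs => rw [f.as_sum_range_C_mul_X_pow, hdeg]
      simp only [Finset.sum_range_succ, Finset.sum_range_zero]
      ring
    have ha : f.coeff 3 ≠ 0 := hdeg ▸ leadingCoeff_ne_zero.mpr hf
    rw [hf'] at hroot ⊢
    exact exists_forall_infinite_of_cubic ha fun q => by simpa using hroot q
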